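/- arXiv:1407.4512 — 8 statements merged into one kernel-verified Lean document; each statement's English description precedes it below -/
import Mathlib

section
/- For every real t > 0, every α ∈ (0,1), and every natural number k, the following identity of convergent double series holds: Σ_{m=k}^∞ Σ_{n=k}^∞ e^{-t} (αt)^m/m! · ((1-α)t)^n/n! · C(m,k)C(n,k)/C(m+n,n) = e^{-t} (α(1-α)t²)^k/(k!)² · Σ_{i=0}^∞ Σ_{j=0}^∞ t^{i+j}/C(i+j+2k, i+k) · α^i/i! · (1-α)^j/j!. Probabilistically: in the call auction model where the numbers M of ask orders and N of bid orders are independent Poisson random variables with parameters αt and (1-α)t respectively (t = λT), and conditionally on M = m, N = n the traded volume V is hypergeometric with P(V = k | M=m, N=n) = C(m,k)C(n,k)/C(m+n,n), the unconditional law of V is given by the right-hand side; it does not depend on the orders' price distribution F. -/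
/-- For every real `t > 0`, every `α ∈ (0,1)` and every natural number `k`,
the Poisson mixture of the conditional hypergeometric laws of the traded volume of the call
auction satisfies the double-series identity
`Σ_{m=k}^∞ Σ_{n=k}^∞ e^{-t} (αt)^m/m! ((1-α)t)^n/n! C(m,k)C(n,k)/C(m+n,n)
  = e^{-t} (α(1-α)t²)^k/(k!)² Σ_{i,j≥0} t^{i+j}/C(i+j+2k,i+k) α^i/i! (1-α)^j/j!`
(the sums over `m ≥ k`, `n ≥ k` are written with the shifts `m = m'+k`, `n = n'+k`). -/
theorem stmt_3 (t α : ℝ) (ht : 0 < t) (hα : α ∈ Set.Ioo (0 : ℝ) 1) (k : ℕ) :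
    (∑' (m : ℕ), ∑' (n : ℕ),
      Real.exp (-t) * ((α * t) ^ (m + k) / ((m + k).factorial : ℝ)) *
        (((1 - α) * t) ^ (n + k) / ((n + k).factorial : ℝ)) *
        ((((m + k).choose k : ℝ) * ((n + k).choose k : ℝ)) /
          ((((m + k) + (n + k)).choose (n + k) : ℝ))))
    = Real.exp (-t) * ((α * (1 - α) * t ^ 2) ^ k / ((k.factorial : ℝ) ^ 2)) *
      ∑' (i : ℕ), ∑' (j : ℕ),
        t ^ (i + j) / (((i + j + 2 * k).choose (i + k) : ℝ)) *
          (α ^ i / (i.factorial : ℝ)) * ((1 - α) ^ j / (j.factorial : ℝ)) := by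
  rw [← tsum_mul_left]
  refine tsum_congr fun m => ?_
  rw [← tsum_mul_left]
  refine tsum_congr fun n => ?_
  have hsymm : (m + n + 2 * k).choose (m + k) = ((m + k) + (n + k)).choose (n + k) := by
    rw [show m + n + 2 * k = (m + k) + (n + k) by ring, Nat.choose_symm_add]
  have hchoose : ((m + k) + (n + k)).choose (n + k) ≠ 0 :=
    (Nat.choose_pos (Nat.le_add_left _ _)).ne'
  have hcast (a : ℕ) : ((a + k).choose k : ℝ) =
      ((a + k).factorial : ℝ) / ((a.factorial : ℝ) * (k.factorial : ℝ)) := by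
    rw [← Nat.choose_symm_add, Nat.cast_add_choose]
  rw [hsymm, hcast m, hcast n]
  generalize ((m + k) + (n + k)).choose (n + k) = c at hchoose
  have hc : (c : ℝ) ≠ 0 := Nat.cast_ne_zero.mpr hchoose
  have hmk : ((m + k).factorial : ℝ) ≠ 0 := Nat.cast_ne_zero.mpr (Nat.factorial_ne_zero _)
  have hnk : ((n + k).factorial : ℝ) ≠ 0 := Nat.cast_ne_zero.mpr (Nat.factorial_ne_zero _)
  simp only [mul_pow, pow_add]
  field_simp
  ring
end

section
/- For every real t > 0 and every natural number k, the following identity holds: Σ_{m=k}^∞ Σ_{n=k}^∞ e^{-t} (t/2)^{m+n}/(m! n!) · C(m,k)C(n,k)/C(m+n,n) = e^{-t/2} (t/2)^{2k} / (2k)! · (1 + t/(2(2k+1))). Probabilistically: in the symmetric call auction model (market imbalance α = 1/2) with total Poisson order rate λ over time T and t = λT, the traded volume V satisfies P(V = k) = e^{-λT/2} (λT/2)^{2k}/(2k)! · (1 + λT/(2(2k+1))). -/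
open Finset in
/-- Convolution identity for the coefficients of `(1 - X)⁻¹ ^ (k + 1)`. -/
theorem sum_antidiagonal_choose_mul_choose (k s : ℕ) :
    ∑ p ∈ antidiagonal s, (p.1 + k).choose k * (p.2 + k).choose k =
      (s + (2 * k + 1)).choose (2 * k + 1) := by
  have h := congrArg (fun u : (PowerSeries ℤ)ˣ => PowerSeries.coeff s u.val)
    (PowerSeries.invOneSubPow_add ℤ (k + 1) (k + 1))
  rw [show k + 1 + (k + 1) = (2 * k + 1) + 1 by ring] at h
  simp only [Units.val_mul, PowerSeries.invOneSubPow_val_succ_eq_mk_add_choose,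
    PowerSeries.coeff_mul, PowerSeries.coeff_mk] at h
  rw [add_comm s, ← Nat.cast_inj (R := ℤ), h]
  push_cast
  exact sum_congr rfl fun p _ => by rw [add_comm p.1, add_comm p.2]

/-- A double series of nonnegative terms may be summed along antidiagonals. -/
theorem tsum_tsum_eq_of_hasSum_antidiagonal {f : ℕ → ℕ → ℝ} {a : ℝ} (hf : ∀ m n, 0 ≤ f m n)
    (h : HasSum (fun s => ∑ p ∈ Finset.HasAntidiagonal.antidiagonal s, f p.1 p.2) a) :
    ∑' m, ∑' n, f m n = a := by
  let e := Finset.HasAntidiagonal.sigmaAntidiagonalEquivProd (A := ℕ)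
  let F : ℕ × ℕ → ℝ := fun p => f p.1 p.2
  have hfib (s : ℕ) : HasSum (fun p : Finset.HasAntidiagonal.antidiagonal s => (F ∘ e) ⟨s, p⟩)
      (∑ p ∈ Finset.HasAntidiagonal.antidiagonal s, f p.1 p.2) :=
    Finset.hasSum (Finset.HasAntidiagonal.antidiagonal s) F
  have hsum : Summable (F ∘ e) :=
    (summable_sigma_of_nonneg fun x => hf _ _).2
      ⟨fun s => (hfib s).summable, h.summable.congr fun s => (hfib s).tsum_eq.symm⟩
  have hF : Summable F := e.summable_iff.1 hsum
  calc ∑' m, ∑' n, f m n = ∑' p, F p := hF.tsum_prod.symm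
    _ = ∑' x, (F ∘ e) x := (e.tsum_eq F).symm
    _ = a := (hsum.hasSum.sigma hfib).unique h

theorem hasSum_pow_div_factorial_mul_add (x c : ℝ) :
    HasSum (fun s : ℕ => x ^ s / (s.factorial : ℝ) * (s + c)) (Real.exp x * (x + c)) := by
  have h : HasSum (fun s : ℕ => x ^ s / (s.factorial : ℝ)) (Real.exp x) := by
    rw [Real.exp_eq_exp_ℝ]
    exact NormedSpace.expSeries_div_hasSum_exp x
  have h' : HasSum (fun s : ℕ => x ^ s / (s.factorial : ℝ) * s) (Real.exp x * x) := by
    rw [← hasSum_nat_add_iff' 1]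
    simp only [Finset.sum_range_one, Nat.cast_zero, mul_zero, sub_zero]
    refine (h.mul_right x).congr_fun fun s => ?_
    rw [Nat.factorial_succ]
    push_cast
    field_simp
    ring
  simpa only [mul_add] using h'.add (h.mul_right c)

/-- The joint weight of `m + k` asks, `n + k` bids and traded volume `k`. -/
theorem pow_div_factorial_mul_choose_div_choose (x : ℝ) (k m n : ℕ) :
    x ^ ((m + k) + (n + k)) / (((m + k).factorial : ℝ) * ((n + k).factorial : ℝ)) *
        ((((m + k).choose k : ℝ) * ((n + k).choose k : ℝ)) /
          ((((m + k) + (n + k)).choose (n + k) : ℝ))) =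
      x ^ (m + n + 2 * k) / ((m + n + 2 * k).factorial : ℝ) *
        (((m + k).choose k * (n + k).choose k : ℕ) : ℝ) := by
  have h : (((m + k) + (n + k)).choose (n + k) : ℝ) * (m + k).factorial * (n + k).factorial =
      ((m + k) + (n + k)).factorial := by
    exact_mod_cast Nat.add_choose_mul_factorial_mul_factorial (m + k) (n + k)
  rw [show m + n + 2 * k = (m + k) + (n + k) by ring, ← h]
  push_cast
  have : (((m + k) + (n + k)).choose (n + k) : ℝ) ≠ 0 := by
    exact_mod_cast (Nat.choose_pos (Nat.le_add_left _ _)).ne'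
  field_simp

/-- For every real `t > 0` and every natural number `k`,
`Σ_{m=k}^∞ Σ_{n=k}^∞ e^{-t} (t/2)^{m+n}/(m! n!) · C(m,k)C(n,k)/C(m+n,n)
  = e^{-t/2} (t/2)^{2k}/(2k)! · (1 + t/(2(2k+1)))`,
i.e. in the symmetric call auction model (`α = 1/2`, `t = λT`) the traded volume `V` satisfies
`P(V = k) = e^{-λT/2} (λT/2)^{2k}/(2k)! (1 + λT/(2(2k+1)))`.
(The sums over `m ≥ k`, `n ≥ k` are written with the shifts `m = m'+k`, `n = n'+k`.) -/
theorem stmt_4 (t : ℝ) (ht : 0 < t) (k : ℕ) :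
    (∑' (m : ℕ), ∑' (n : ℕ),
      Real.exp (-t) * ((t / 2) ^ ((m + k) + (n + k)) /
          (((m + k).factorial : ℝ) * ((n + k).factorial : ℝ))) *
        ((((m + k).choose k : ℝ) * ((n + k).choose k : ℝ)) /
          ((((m + k) + (n + k)).choose (n + k) : ℝ))))
    = Real.exp (-t / 2) * ((t / 2) ^ (2 * k) / (((2 * k).factorial : ℝ))) *
      (1 + t / (2 * (2 * (k : ℝ) + 1))) := by
  refine tsum_tsum_eq_of_hasSum_antidiagonal (fun m n => by positivity) ?_
  have h := (hasSum_pow_div_factorial_mul_add (t / 2) (2 * k + 1)).mul_left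
    (Real.exp (-t) * ((t / 2) ^ (2 * k) / ((2 * k + 1).factorial : ℝ)))
  have hvalue : Real.exp (-t / 2) * ((t / 2) ^ (2 * k) / (((2 * k).factorial : ℝ))) *
      (1 + t / (2 * (2 * (k : ℝ) + 1))) =
      Real.exp (-t) * ((t / 2) ^ (2 * k) / ((2 * k + 1).factorial : ℝ)) *
        (Real.exp (t / 2) * (t / 2 + (2 * k + 1))) := by
    have hexp : Real.exp (-t / 2) = Real.exp (-t) * Real.exp (t / 2) := by
      rw [← Real.exp_add]
      ring_nf
    rw [hexp, Nat.factorial_succ]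
    push_cast
    field_simp
    ring
  rw [hvalue]
  refine h.congr_fun fun s => ?_
  have hdiag : ∀ p ∈ Finset.HasAntidiagonal.antidiagonal s,
      Real.exp (-t) * ((t / 2) ^ ((p.1 + k) + (p.2 + k)) /
          (((p.1 + k).factorial : ℝ) * ((p.2 + k).factorial : ℝ))) *
        ((((p.1 + k).choose k : ℝ) * ((p.2 + k).choose k : ℝ)) /
          ((((p.1 + k) + (p.2 + k)).choose (p.2 + k) : ℝ))) =
      Real.exp (-t) * ((t / 2) ^ (s + 2 * k) / ((s + 2 * k).factorial : ℝ)) *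
        (((p.1 + k).choose k * (p.2 + k).choose k : ℕ) : ℝ) := fun p hp => by
    rw [mul_assoc, pow_div_factorial_mul_choose_div_choose,
      Finset.HasAntidiagonal.mem_antidiagonal.1 hp, mul_assoc]
  have hc : ((s + (2 * k + 1)).choose (2 * k + 1) : ℝ) * s.factorial * (2 * k + 1).factorial =
      (s + 2 * k + 1) * (s + 2 * k).factorial := by
    have := Nat.add_choose_mul_factorial_mul_factorial s (2 * k + 1)
    rw [← add_assoc, Nat.factorial_succ (s + 2 * k)] at this
    exact_mod_cast this
  rw [Finset.sum_congr rfl hdiag, ← Finset.mul_sum, ← Nat.cast_sum,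
    sum_antidiagonal_choose_mul_choose, pow_add]
  field_simp
  linear_combination hc
end

section
/- For every real t > 0 and every α ∈ (0,1) with α ≠ 1/2, the following identity holds: Σ_{m=0}^∞ Σ_{n=0}^∞ e^{-t} (αt)^m ((1-α)t)^n / (m+n)! = e^{-αt} + (α/(1-2α)) (e^{-αt} - e^{-(1-α)t}). Probabilistically: in the call auction model with total order rate λ, market imbalance α ≠ 1/2 and auction length T (t = λT), the probability that no trade occurs at the clearing is P(V = 0) = e^{-αλT} + (α/(1-2α)) (e^{-αλT} - e^{-(1-α)λT}). -/
theorem summable_pow_mul_pow_div_factorial_add {x y : ℝ} (hx : 0 ≤ x) (hy : 0 ≤ y) :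
    Summable fun p : ℕ × ℕ => x ^ p.1 * y ^ p.2 / ((p.1 + p.2).factorial : ℝ) := by
  refine Summable.of_nonneg_of_le (fun p => by positivity) (fun p => ?_)
    ((Real.summable_pow_div_factorial x).mul_of_nonneg (Real.summable_pow_div_factorial y)
      (fun n => by positivity) (fun n => by positivity))
  rw [div_mul_div_comm]
  gcongr
  exact_mod_cast Nat.le_of_dvd (Nat.factorial_pos _)
    (Nat.factorial_mul_factorial_dvd_factorial_add _ _)

theorem hasSum_pow_succ_div_factorial (x : ℝ) :
    HasSum (fun n : ℕ => x ^ (n + 1) / (n.factorial : ℝ)) (x * Real.exp x) := by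
  have h := (NormedSpace.expSeries_div_hasSum_exp x).mul_left x
  rw [← Real.exp_eq_exp_ℝ] at h
  exact h.congr_fun fun n => by ring

theorem sum_antidiagonal_pow_mul_pow_div_factorial {x y : ℝ} (hxy : x ≠ y) (N : ℕ) :
    ∑ p ∈ Finset.HasAntidiagonal.antidiagonal N, x ^ p.1 * y ^ p.2 / ((p.1 + p.2).factorial : ℝ) =
      (x ^ (N + 1) / (N.factorial : ℝ) - y ^ (N + 1) / (N.factorial : ℝ)) / (x - y) := by
  have h : ∑ p ∈ Finset.HasAntidiagonal.antidiagonal N,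
      x ^ p.1 * y ^ p.2 / ((p.1 + p.2).factorial : ℝ) =
      (∑ p ∈ Finset.HasAntidiagonal.antidiagonal N, x ^ p.1 * y ^ p.2) / (N.factorial : ℝ) := by
    rw [Finset.sum_div]
    refine Finset.sum_congr rfl fun p hp => ?_
    rw [Finset.HasAntidiagonal.mem_antidiagonal.mp hp]
  have hg := geom_sum₂_mul x y (N + 1)
  simp only [Nat.add_sub_cancel] at hg
  rw [h, Finset.Nat.sum_antidiagonal_eq_sum_range_succ (fun i j => x ^ i * y ^ j),
    eq_div_iff (sub_ne_zero.mpr hxy), div_mul_eq_mul_div, hg, sub_div]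

theorem tsum_tsum_pow_mul_pow_div_factorial_add {x y : ℝ} (hx : 0 ≤ x) (hy : 0 ≤ y)
    (hxy : x ≠ y) :
    ∑' (m : ℕ), ∑' (n : ℕ), x ^ m * y ^ n / ((m + n).factorial : ℝ) =
      (x * Real.exp x - y * Real.exp y) / (x - y) := by
  have hs := summable_pow_mul_pow_div_factorial_add hx hy
  have hsum := (Finset.HasAntidiagonal.sigmaAntidiagonalEquivProd.hasSum_iff.mpr
    hs.hasSum).sigma fun N => hasSum_fintype _
  rw [← hs.tsum_prod]
  refine hsum.unique ((((hasSum_pow_succ_div_factorial x).sub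
    (hasSum_pow_succ_div_factorial y)).div_const (x - y)).congr_fun fun N => ?_)
  rw [← sum_antidiagonal_pow_mul_pow_div_factorial hxy N]
  exact Finset.sum_coe_sort (Finset.HasAntidiagonal.antidiagonal N)
    fun p : ℕ × ℕ => x ^ p.1 * y ^ p.2 / ((p.1 + p.2).factorial : ℝ)

/-- For every real `t > 0` and every `α ∈ (0,1)` with `α ≠ 1/2`,
`Σ_{m=0}^∞ Σ_{n=0}^∞ e^{-t} (αt)^m ((1-α)t)^n / (m+n)!
  = e^{-αt} + (α/(1-2α)) (e^{-αt} - e^{-(1-α)t})`,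
i.e. in the call auction model with imbalance `α ≠ 1/2` and `t = λT`, the probability that no
trade occurs is `P(V = 0) = e^{-αλT} + (α/(1-2α))(e^{-αλT} - e^{-(1-α)λT})`. -/
theorem stmt_5 (t α : ℝ) (ht : 0 < t) (hα : α ∈ Set.Ioo (0 : ℝ) 1) (hα2 : α ≠ 1 / 2) :
    (∑' (m : ℕ), ∑' (n : ℕ),
      Real.exp (-t) * (α * t) ^ m * ((1 - α) * t) ^ n / ((m + n).factorial : ℝ))
    = Real.exp (-(α * t)) +
        α / (1 - 2 * α) * (Real.exp (-(α * t)) - Real.exp (-((1 - α) * t))) := by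
  obtain ⟨h0, h1⟩ := hα
  have hα' : 1 - 2 * α ≠ 0 := fun h => hα2 (by linarith)
  have hxy : α * t ≠ (1 - α) * t := fun h =>
    hα2 (by linarith [mul_right_cancel₀ ht.ne' h])
  simp only [mul_assoc (Real.exp (-t)), mul_div_assoc (Real.exp (-t)), tsum_mul_left]
  rw [tsum_tsum_pow_mul_pow_div_factorial_add (by positivity)
    (mul_nonneg (by linarith) ht.le) hxy]
  have e1 : Real.exp (-((1 - α) * t)) = Real.exp (-t) * Real.exp (α * t) := by
    rw [← Real.exp_add]; ring_nf
  have e2 : Real.exp (-(α * t)) = Real.exp (-t) * Real.exp ((1 - α) * t) := by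
    rw [← Real.exp_add]; ring_nf
  have hsub : α * t - (1 - α) * t = -(t * (1 - 2 * α)) := by ring
  rw [e1, e2, hsub]
  generalize Real.exp (α * t) = a
  generalize Real.exp ((1 - α) * t) = b
  have hsolve : α = (1 - (1 - 2 * α)) / 2 := by ring
  generalize 1 - 2 * α = d at *
  subst hsolve
  field_simp
  ring
end

section
/- For every real t > 0, the following identity holds: Σ_{m=0}^∞ Σ_{n=0}^∞ e^{-t} (t/2)^{m+n} / (m+n)! = e^{-t/2} (1 + t/2). Probabilistically: in the symmetric call auction model (α = 1/2) with total order rate λ and auction length T (t = λT), the probability that no trade occurs at the clearing is P(V = 0) = e^{-λT/2} (1 + λT/2). -/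
open Finset in
/-- Summing a nonnegative function of `m + n` over pairs weights each value `k` by the number
`k + 1` of pairs on its antidiagonal. -/
lemma hasSum_add_of_hasSum_succ_mul {g : ℕ → ℝ} (hg : ∀ k, 0 ≤ g k) {s : ℝ}
    (h : HasSum (fun k : ℕ => ((k : ℝ) + 1) * g k) s) :
    HasSum (fun p : ℕ × ℕ => g (p.1 + p.2)) s := by
  rw [← Equiv.hasSum_iff HasAntidiagonal.sigmaAntidiagonalEquivProd]
  have hfiber : ∀ k : ℕ, HasSum (fun p : HasAntidiagonal.antidiagonal k => g (p.1.1 + p.1.2))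
      (((k : ℝ) + 1) * g k) := by
    intro k
    have hconst : (fun p : HasAntidiagonal.antidiagonal k => g (p.1.1 + p.1.2)) =
        fun _ => g k := by
      funext p
      rw [HasAntidiagonal.mem_antidiagonal.mp p.2]
    rw [hconst]
    convert hasSum_fintype (fun _ : HasAntidiagonal.antidiagonal k => g k) using 1
    simp
  have hsum : Summable ((fun p : ℕ × ℕ => g (p.1 + p.2)) ∘
      HasAntidiagonal.sigmaAntidiagonalEquivProd) := by
    refine (summable_sigma_of_nonneg fun _ => hg _).mpr ⟨fun k => (hfiber k).summable, ?_⟩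
    exact h.summable.congr fun k => (hfiber k).tsum_eq.symm
  exact (hsum.hasSum.sigma hfiber).unique h ▸ hsum.hasSum

lemma hasSum_pow_div_factorial (x : ℝ) :
    HasSum (fun k : ℕ => x ^ k / (k.factorial : ℝ)) (Real.exp x) := by
  rw [Real.exp_eq_exp_ℝ]
  exact NormedSpace.expSeries_div_hasSum_exp x

lemma hasSum_succ_mul_pow_div_factorial (x : ℝ) :
    HasSum (fun k : ℕ => ((k : ℝ) + 1) * (x ^ k / (k.factorial : ℝ))) (Real.exp x * (1 + x)) := by
  have hshift : HasSum (fun k : ℕ => (k : ℝ) * (x ^ k / (k.factorial : ℝ))) (x * Real.exp x) := by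
    rw [← hasSum_nat_add_iff' 1]
    have hterm : (fun k : ℕ => ((k + 1 : ℕ) : ℝ) * (x ^ (k + 1) / ((k + 1).factorial : ℝ))) =
        fun k => x * (x ^ k / (k.factorial : ℝ)) := by
      funext k
      rw [Nat.factorial_succ]
      push_cast
      field_simp
      ring
    rw [hterm]
    simpa using (hasSum_pow_div_factorial x).mul_left x
  convert hshift.add (hasSum_pow_div_factorial x) using 1
  · funext k
    ring
  · ring

/-- For every real `t > 0`,
`Σ_{m=0}^∞ Σ_{n=0}^∞ e^{-t} (t/2)^{m+n} / (m+n)! = e^{-t/2} (1 + t/2)`,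
i.e. in the symmetric call auction model (`α = 1/2`, `t = λT`) the probability that no trade
occurs at the clearing is `P(V = 0) = e^{-λT/2}(1 + λT/2)`. -/
theorem stmt_6 (t : ℝ) (ht : 0 < t) :
    (∑' (m : ℕ), ∑' (n : ℕ), Real.exp (-t) * (t / 2) ^ (m + n) / ((m + n).factorial : ℝ))
    = Real.exp (-t / 2) * (1 + t / 2) := by
  have hpair := hasSum_add_of_hasSum_succ_mul
    (g := fun k => (t / 2) ^ k / (k.factorial : ℝ)) (fun k => by positivity)
    (hasSum_succ_mul_pow_div_factorial (t / 2))
  have hscaled := hpair.mul_left (Real.exp (-t))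
  simp only [mul_div_assoc]
  rw [← hscaled.summable.tsum_prod, hscaled.tsum_eq, ← mul_assoc, ← Real.exp_add]
  congr 2
  ring
end

section
/- Fix α ∈ (0,1). For each t > 0, let M_t and N_t be independent Poisson random variables with parameters αt and (1-α)t, and let V_t be a random variable whose conditional law given M_t = m, N_t = n is hypergeometric: P(V_t = k | M_t = m, N_t = n) = C(m,k)C(n,k)/C(m+n,n) for 0 ≤ k ≤ min(m,n). Then, as t → ∞, the random variable (V_t − t α(1−α)) / sqrt(t α(1−α)(1 − 2α(1−α))) converges in distribution to the standard normal law N(0,1). -/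
open MeasureTheory ProbabilityTheory Filter Topology

/-- The generating polynomial `∑ₖ C(m,k) C(n,k) zᵏ` of products of binomial coefficients. -/
noncomputable def choosePoly (z : ℂ) (m n : ℕ) : ℂ :=
  ∑ k ∈ Finset.range (m + 1), (m.choose k : ℂ) * (n.choose k : ℂ) * z ^ k

theorem choosePoly_eq_sum_range (z : ℂ) {m n K : ℕ} (h : m < K) :
    choosePoly z m n = ∑ k ∈ Finset.range K, (m.choose k : ℂ) * (n.choose k : ℂ) * z ^ k := by
  refine Finset.sum_subset (Finset.range_subset_range.2 h) fun k _ hk => ?_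
  rw [Nat.choose_eq_zero_of_lt (by simpa using hk)]
  simp

theorem choosePoly_zero_left (z : ℂ) (n : ℕ) : choosePoly z 0 n = 1 := by
  simp [choosePoly]

theorem choosePoly_zero_right (z : ℂ) (m : ℕ) : choosePoly z m 0 = 1 := by
  simp [choosePoly, Finset.sum_range_succ']

theorem choosePoly_succ_succ (z : ℂ) (m n : ℕ) :
    choosePoly z (m + 1) (n + 1)
      = choosePoly z (m + 1) n + choosePoly z m (n + 1) - (1 - z) * choosePoly z m n := by
  have h₀ : choosePoly z m n - 1 = ∑ k ∈ Finset.range (m + 1),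
      (m.choose (k + 1) : ℂ) * (n.choose (k + 1) : ℂ) * z ^ (k + 1) := by
    rw [choosePoly_eq_sum_range z (show m < m + 2 by omega), Finset.sum_range_succ']
    simp
  have h₁ : z * choosePoly z m n = ∑ k ∈ Finset.range (m + 1),
      (m.choose k : ℂ) * (n.choose k : ℂ) * z ^ (k + 1) := by
    rw [choosePoly, Finset.mul_sum]
    exact Finset.sum_congr rfl fun k _ => by ring
  have h₂ : choosePoly z m (n + 1) - 1 = ∑ k ∈ Finset.range (m + 1),
      (m.choose (k + 1) : ℂ) * ((n + 1).choose (k + 1) : ℂ) * z ^ (k + 1) := by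
    rw [choosePoly_eq_sum_range z (show m < m + 2 by omega), Finset.sum_range_succ']
    simp
  have h₃ (j : ℕ) : choosePoly z (m + 1) j - 1 = ∑ k ∈ Finset.range (m + 1),
      ((m + 1).choose (k + 1) : ℂ) * (j.choose (k + 1) : ℂ) * z ^ (k + 1) := by
    rw [choosePoly, Finset.sum_range_succ']
    simp
  have key : choosePoly z (m + 1) (n + 1) - 1 = (choosePoly z (m + 1) n - 1)
      + (choosePoly z m (n + 1) - 1) + z * choosePoly z m n - (choosePoly z m n - 1) := by
    rw [h₀, h₁, h₂, h₃, h₃, ← Finset.sum_add_distrib, ← Finset.sum_add_distrib,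
      ← Finset.sum_sub_distrib]
    refine Finset.sum_congr rfl fun k _ => ?_
    simp only [Nat.choose_succ_succ', Nat.cast_add]
    ring
  linear_combination key

/-- The diagonal coefficients `∑_{m+n=L} aᵐ bⁿ choosePoly z m n`. -/
noncomputable def chooseDiag (a b z : ℂ) (L : ℕ) : ℂ :=
  ∑ p ∈ Finset.HasAntidiagonal.antidiagonal L, a ^ p.1 * b ^ p.2 * choosePoly z p.1 p.2

theorem chooseDiag_succ_succ (a b z : ℂ) (L : ℕ) :
    chooseDiag a b z (L + 2)
      = (a + b) * chooseDiag a b z (L + 1) - a * b * (1 - z) * chooseDiag a b z L := by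
  have h₁ : a * b * ∑ p ∈ Finset.HasAntidiagonal.antidiagonal L, a ^ p.1 * b ^ p.2 * choosePoly z (p.1 + 1) p.2
      = b * (chooseDiag a b z (L + 1) - b ^ (L + 1)) := by
    rw [chooseDiag, Finset.Nat.sum_antidiagonal_succ, choosePoly_zero_left, pow_zero, one_mul,
      mul_one, add_sub_cancel_left, Finset.mul_sum, Finset.mul_sum]
    exact Finset.sum_congr rfl fun k _ => by ring
  have h₂ : a * b * ∑ p ∈ Finset.HasAntidiagonal.antidiagonal L, a ^ p.1 * b ^ p.2 * choosePoly z p.1 (p.2 + 1)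
      = a * (chooseDiag a b z (L + 1) - a ^ (L + 1)) := by
    rw [chooseDiag, Finset.Nat.sum_antidiagonal_succ', choosePoly_zero_right, pow_zero,
      mul_one, mul_one, add_sub_cancel_left, Finset.mul_sum, Finset.mul_sum]
    exact Finset.sum_congr rfl fun k _ => by ring
  have h₃ : ∑ p ∈ Finset.HasAntidiagonal.antidiagonal L,
      a ^ (p.1 + 1) * b ^ (p.2 + 1) * choosePoly z (p.1 + 1) (p.2 + 1)
      = a * b * ∑ p ∈ Finset.HasAntidiagonal.antidiagonal L, a ^ p.1 * b ^ p.2 * choosePoly z (p.1 + 1) p.2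
      + a * b * ∑ p ∈ Finset.HasAntidiagonal.antidiagonal L, a ^ p.1 * b ^ p.2 * choosePoly z p.1 (p.2 + 1)
      - a * b * (1 - z) * chooseDiag a b z L := by
    rw [chooseDiag, Finset.mul_sum, Finset.mul_sum, Finset.mul_sum, ← Finset.sum_add_distrib,
      ← Finset.sum_sub_distrib]
    refine Finset.sum_congr rfl fun k _ => ?_
    rw [choosePoly_succ_succ]
    ring
  have h₄ : chooseDiag a b z (L + 2) = b ^ (L + 2) + (a ^ (L + 2)
      + ∑ p ∈ Finset.HasAntidiagonal.antidiagonal L,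
        a ^ (p.1 + 1) * b ^ (p.2 + 1) * choosePoly z (p.1 + 1) (p.2 + 1)) := by
    rw [chooseDiag, Finset.Nat.sum_antidiagonal_succ, Finset.Nat.sum_antidiagonal_succ',
      choosePoly_zero_left, choosePoly_zero_right]
    simp
  rw [h₄, h₃, h₁, h₂]
  ring

theorem sub_mul_chooseDiag {a b z r s : ℂ} (hab : a + b = 1) (hrs : r + s = 1)
    (h : r * s = a * b * (1 - z)) (L : ℕ) :
    (r - s) * chooseDiag a b z L = r ^ (L + 1) - s ^ (L + 1) := by
  induction L using Nat.twoStepInduction with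
  | zero => simp [chooseDiag, choosePoly]
  | one =>
    have : chooseDiag a b z 1 = 1 := by
      rw [← hab, chooseDiag, Finset.Nat.sum_antidiagonal_succ]
      simp [choosePoly_zero_left, choosePoly_zero_right, add_comm]
    rw [this]
    linear_combination (-(r - s)) * hrs
  | more L ih₀ ih₁ =>
    rw [chooseDiag_succ_succ, hab, ← h]
    linear_combination ih₁ - r * s * ih₀ - (r ^ (L + 2) - s ^ (L + 2)) * hrs

/-- The joint probability mass function of `((M, N), V)` at time `t`. -/
noncomputable def auctionWeight (α t : ℝ) (i : (ℕ × ℕ) × ℕ) : ℝ :=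
  Real.exp (-t) * (t ^ (i.1.1 + i.1.2) / ((i.1.1 + i.1.2).factorial : ℝ)) *
    (α ^ i.1.1 * (1 - α) ^ i.1.2 * ((i.1.1.choose i.2 : ℝ) * (i.1.2.choose i.2 : ℝ)))

/-- Closed form of the probability generating function of `V`. -/
theorem sub_mul_tsum_auctionWeight {α t : ℝ} {z r s : ℂ} (hz : ‖z‖ ≤ 1)
    (hw : Summable (auctionWeight α t)) (hrs : r + s = 1)
    (h : r * s = α * (1 - α) * (1 - z)) :
    (r - s) * ∑' i, (auctionWeight α t i : ℂ) * z ^ i.2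
      = Complex.exp (-t) * (r * Complex.exp (t * r) - s * Complex.exp (t * s)) := by
  have hsum : Summable fun i => (auctionWeight α t i : ℂ) * z ^ i.2 := by
    refine Summable.of_norm_bounded hw.norm fun i => ?_
    rw [norm_mul, norm_pow, Complex.norm_real]
    exact mul_le_of_le_one_right (norm_nonneg _) (pow_le_one₀ (norm_nonneg _) hz)
  have hinner (p : ℕ × ℕ) : HasSum (fun k => (auctionWeight α t (p, k) : ℂ) * z ^ k)
      (Complex.exp (-t) * ((t : ℂ) ^ (p.1 + p.2) / ((p.1 + p.2).factorial : ℂ)) *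
        ((α : ℂ) ^ p.1 * (1 - α : ℂ) ^ p.2 * choosePoly z p.1 p.2)) := by
    have := hasSum_sum_of_ne_finset_zero (f := fun k => (auctionWeight α t (p, k) : ℂ) * z ^ k)
      (s := Finset.range (p.1 + 1)) (L := .unconditional ℕ) (fun k hk => by
        rw [auctionWeight, Nat.choose_eq_zero_of_lt (show p.1 < k by simpa using hk)]
        simp)
    convert this using 1
    rw [choosePoly, Finset.mul_sum, Finset.mul_sum]
    refine Finset.sum_congr rfl fun k _ => ?_
    simp only [auctionWeight]
    push_cast
    ring
  have hpair := hsum.hasSum.prod_fiberwise hinner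
  rw [← Finset.HasAntidiagonal.sigmaAntidiagonalEquivProd.hasSum_iff] at hpair
  have hdiag := hpair.sigma (g := fun L => Complex.exp (-t) * ((t : ℂ) ^ L / (L.factorial : ℂ)) *
      chooseDiag α (1 - α) z L) (fun L => by
    have := Finset.hasSum (Finset.HasAntidiagonal.antidiagonal L) (fun p : ℕ × ℕ =>
      Complex.exp (-t) * ((t : ℂ) ^ (p.1 + p.2) / ((p.1 + p.2).factorial : ℂ)) *
        ((α : ℂ) ^ p.1 * (1 - α : ℂ) ^ p.2 * choosePoly z p.1 p.2))
    have hval : Complex.exp (-t) * ((t : ℂ) ^ L / (L.factorial : ℂ)) * chooseDiag α (1 - α) z L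
        = ∑ p ∈ Finset.HasAntidiagonal.antidiagonal L,
          Complex.exp (-t) * ((t : ℂ) ^ (p.1 + p.2) / ((p.1 + p.2).factorial : ℂ)) *
            ((α : ℂ) ^ p.1 * (1 - α : ℂ) ^ p.2 * choosePoly z p.1 p.2) := by
      rw [chooseDiag, Finset.mul_sum]
      refine Finset.sum_congr rfl fun p hp => ?_
      rw [Finset.HasAntidiagonal.mem_antidiagonal.1 hp]
    rw [hval]
    exact this)
  have hexp (c : ℂ) : HasSum (fun L : ℕ => (t * c) ^ L / (L.factorial : ℂ))
      (Complex.exp (t * c)) := by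
    simpa [Complex.exp_eq_exp_ℂ] using NormedSpace.expSeries_div_hasSum_exp ((t : ℂ) * c)
  have hrhs := (((hexp r).mul_left r).sub ((hexp s).mul_left s)).mul_left (Complex.exp (-t))
  refine (hdiag.mul_left (r - s)).unique ?_
  convert hrhs using 1
  funext L
  have := sub_mul_chooseDiag (a := α) (b := 1 - α) (z := z) (by ring) hrs h L
  simp only [mul_pow]
  linear_combination (Complex.exp (-t) * ((t : ℂ) ^ L / (L.factorial : ℂ))) * this

theorem exists_exp_eq_one_add_add_sq_mul :
    ∃ h : ℂ → ℂ, Tendsto h (𝓝 0) (𝓝 (1 / 2)) ∧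
      ∀ x, Complex.exp x = 1 + x + x ^ 2 * h x := by
  classical
  refine ⟨fun x => if x = 0 then 1 / 2 else (Complex.exp x - 1 - x) / x ^ 2, ?_, fun x => ?_⟩
  · have ho := (Complex.exp_sub_sum_range_succ_isLittleO_pow 2).tendsto_div_nhds_zero
    have := ho.add_const (1 / 2 : ℂ)
    rw [zero_add] at this
    refine this.congr fun x => ?_
    split_ifs with hx
    · simp [hx]
    · simp only [Finset.sum_range_succ, Finset.sum_range_zero, Nat.factorial]
      field_simp
      push_cast
      ring
  · dsimp only
    split_ifs with hx
    · simp [hx]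
    · field_simp
      ring

theorem exists_tendsto_zero_mul_one_sub_eq :
    ∃ ρ : ℂ → ℂ, Tendsto ρ (𝓝 0) (𝓝 0) ∧ ∀ w, (1 - ρ w) * ρ w = w := by
  refine ⟨fun w => (1 - (1 - 4 * w) ^ ((2 : ℕ) : ℂ)⁻¹) / 2, ?_, fun w => ?_⟩
  · have hc : ContinuousAt (fun w : ℂ => (1 - (1 - 4 * w) ^ ((2 : ℕ) : ℂ)⁻¹) / 2) 0 := by
      have : ContinuousAt (fun w : ℂ => (1 - 4 * w) ^ ((2 : ℕ) : ℂ)⁻¹) 0 :=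
        ContinuousAt.cpow (by fun_prop) continuousAt_const (by simp)
      exact (continuousAt_const.sub this).div_const 2
    simpa [ContinuousAt] using hc
  · have := Complex.cpow_nat_inv_pow (1 - 4 * w) (two_ne_zero)
    linear_combination (-1 / 4 : ℂ) * this

/-- The closed form of the characteristic function of the normalized volume converges to that of
the standard Gaussian law. -/
theorem exists_roots_tendsto {p : ℝ} (hp : 0 < p * (1 - 2 * p)) (u : ℝ) {θ : ℝ → ℂ}
    (hθ : ∀ t, 0 < t → θ t = ((u / Real.sqrt (t * p * (1 - 2 * p)) : ℝ) : ℂ) * Complex.I) :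
    ∃ s : ℝ → ℂ, (∀ t, (1 - s t) * s t = p * (1 - Complex.exp (θ t))) ∧
      (∀ᶠ t in atTop, (1 - s t) - s t ≠ 0) ∧
      Tendsto (fun t : ℝ => Complex.exp (-t) * ((1 - s t) * Complex.exp (t * (1 - s t))
          - s t * Complex.exp (t * s t)) / ((1 - s t) - s t) * Complex.exp (-(t * p * θ t)))
        atTop (𝓝 (Complex.exp (-(u ^ 2 / 2)))) := by
  obtain ⟨h, hh, hexp⟩ := exists_exp_eq_one_add_add_sq_mul
  obtain ⟨ρ, hρ, hroot⟩ := exists_tendsto_zero_mul_one_sub_eq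
  have hθ0 : Tendsto θ atTop (𝓝 0) := by
    have h1 : Tendsto (fun t : ℝ => Real.sqrt (t * p * (1 - 2 * p))) atTop atTop := by
      refine Real.tendsto_sqrt_atTop.comp ?_
      simp_rw [mul_assoc]
      exact tendsto_id.atTop_mul_const hp
    have h2 := (Complex.continuous_ofReal.tendsto 0).comp (h1.const_div_atTop u)
    have h3 := h2.mul_const Complex.I
    simp only [Complex.ofReal_zero, zero_mul] at h3
    refine h3.congr' ?_
    filter_upwards [eventually_gt_atTop 0] with t ht
    rw [hθ t ht]
    rfl
  have hθsq : ∀ t : ℝ, 0 < t → (t : ℂ) * θ t ^ 2 = -((u ^ 2 / (p * (1 - 2 * p)) : ℝ) : ℂ) := by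
    intro t ht
    have hs : Real.sqrt (t * p * (1 - 2 * p)) ^ 2 = t * (p * (1 - 2 * p)) := by
      rw [Real.sq_sqrt (by rw [mul_assoc]; positivity)]; ring
    rw [hθ t ht, mul_pow, Complex.I_sq, ← Complex.ofReal_pow, div_pow, hs, mul_neg_one, mul_neg,
      ← Complex.ofReal_mul]
    congr 2
    field_simp
  set T : ℂ := -((u ^ 2 / (p * (1 - 2 * p)) : ℝ) : ℂ) with hT
  let s : ℝ → ℂ := fun t => ρ (p * (1 - Complex.exp (θ t)))
  have hs0 : Tendsto s atTop (𝓝 0) := by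
    refine hρ.comp ?_
    have : Continuous fun x : ℂ => p * (1 - Complex.exp x) := by fun_prop
    simpa [Function.comp_def] using (this.tendsto 0).comp hθ0
  have hsr : ∀ t, (1 - s t) * s t = p * (1 - Complex.exp (θ t)) := fun t => hroot _
  have hr1 : Tendsto (fun t => 1 - s t) atTop (𝓝 1) := by
    simpa using hs0.const_sub 1
  have hd1 : Tendsto (fun t => (1 - s t) - s t) atTop (𝓝 1) := by
    simpa using hr1.sub hs0
  have hhθ : Tendsto (fun t => h (θ t)) atTop (𝓝 (1 / 2)) := hh.comp hθ0
  have hE : Tendsto (fun t : ℝ => -(t * s t + t * p * θ t)) atTop (𝓝 (-(u ^ 2 / 2))) := by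
    have hlim : Tendsto (fun t => -(-p * T * h (θ t)
        + p ^ 2 * T * (1 + θ t * h (θ t)) ^ 2 / (1 - s t) ^ 2)) atTop
        (𝓝 (-(-p * T * (1 / 2) + p ^ 2 * T * (1 + 0 * (1 / 2)) ^ 2 / 1 ^ 2))) :=
      ((hhθ.const_mul _).add (((((hθ0.mul hhθ).const_add 1).pow 2).const_mul _).div
        (hr1.pow 2) (by simp))).neg
    have hval : -(-p * T * (1 / 2) + p ^ 2 * T * (1 + 0 * (1 / 2)) ^ 2 / 1 ^ 2)
        = -((u : ℂ) ^ 2 / 2) := by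
      have hp' : (p : ℂ) * (1 - 2 * p) ≠ 0 := by exact_mod_cast hp.ne'
      have hTp : T * (p * (1 - 2 * p)) = -(u : ℂ) ^ 2 := by
        rw [hT, neg_mul]
        push_cast
        rw [div_mul_cancel₀ _ hp']
      linear_combination (1 / 2 : ℂ) * hTp
    rw [hval] at hlim
    refine hlim.congr' ?_
    filter_upwards [eventually_gt_atTop 0, hr1.eventually_ne one_ne_zero] with t ht hne
    have e1 := hsr t
    have e2 : s t = p * (1 - Complex.exp (θ t)) + (p * (1 - Complex.exp (θ t)) / (1 - s t)) ^ 2 := by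
      rw [← e1]; field_simp; ring
    have e3 : (t : ℂ) * s t = t * (p * (1 - Complex.exp (θ t)))
        + t * (p * (1 - Complex.exp (θ t))) ^ 2 / (1 - s t) ^ 2 := by
      conv_lhs => rw [e2]
      field_simp
    rw [e3, hexp (θ t), ← hθsq t ht]
    field_simp
    ring
  refine ⟨s, hsr, hd1.eventually_ne one_ne_zero, ?_⟩
  have hA := (hr1.mul ((Complex.continuous_exp.tendsto _).comp hE)).div hd1 one_ne_zero
  have hB : Tendsto (fun t : ℝ => s t * Complex.exp (-(t * (1 - s t)) - t * p * θ t)) atTop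
      (𝓝 0) := by
    refine squeeze_zero_norm' ?_ (tendsto_zero_iff_norm_tendsto_zero.1 hs0)
    have hre : Tendsto (fun t => (1 - s t).re) atTop (𝓝 1) := by
      exact (Complex.continuous_re.tendsto 1).comp hr1
    filter_upwards [eventually_gt_atTop 0, hre.eventually (lt_mem_nhds zero_lt_one)] with t ht hpos
    rw [norm_mul]
    refine mul_le_of_le_one_right (norm_nonneg _) ?_
    rw [Complex.norm_exp, Real.exp_le_one_iff, hθ t ht]
    have : 0 ≤ t * (1 - s t).re := by positivity
    simpa [Complex.mul_re, Complex.mul_im] using this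
  have hC := hA.sub (hB.div hd1 one_ne_zero)
  simp only [one_mul, div_one, sub_zero] at hC
  refine hC.congr fun t => ?_
  simp only [Pi.div_apply, Function.comp_apply]
  have f1 : Complex.exp (-(t * s t + t * p * θ t))
      = Complex.exp (-t) * Complex.exp (t * (1 - s t)) * Complex.exp (-(t * p * θ t)) := by
    rw [← Complex.exp_add, ← Complex.exp_add]; congr 1; ring
  have f2 : Complex.exp (-(t * (1 - s t)) - t * p * θ t)
      = Complex.exp (-t) * Complex.exp (t * s t) * Complex.exp (-(t * p * θ t)) := by
    rw [← Complex.exp_add, ← Complex.exp_add]; congr 1; ring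
  rw [f1, f2]
  ring

theorem measure_preimage_eq_tsum {Ω ι : Type*} [MeasurableSpace Ω] [Countable ι] {μ : Measure Ω}
    [IsProbabilityMeasure μ] {W : Ω → ι} (h : ∑' i, μ (W ⁻¹' {i}) = 1) (S : Set ι) :
    μ (W ⁻¹' S) = ∑' i, S.indicator (fun i => μ (W ⁻¹' {i})) i := by
  have hle (S : Set ι) : μ (W ⁻¹' S) ≤ ∑' i, S.indicator (fun i => μ (W ⁻¹' {i})) i := by
    rw [← tsum_subtype S fun i => μ (W ⁻¹' {i})]
    refine (measure_mono ?_).trans (measure_iUnion_le _)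
    intro ω hω
    exact Set.mem_iUnion.2 ⟨⟨W ω, hω⟩, rfl⟩
  have hadd : ∑' i, S.indicator (fun i => μ (W ⁻¹' {i})) i
      + ∑' i, Sᶜ.indicator (fun i => μ (W ⁻¹' {i})) i = 1 := by
    rw [← ENNReal.tsum_add, ← h]
    exact tsum_congr fun i => congrFun (Set.indicator_self_add_compl S _) i
  refine le_antisymm (hle S) ?_
  have hfin : ∑' i, Sᶜ.indicator (fun i => μ (W ⁻¹' {i})) i ≠ ⊤ :=
    ne_top_of_le_ne_top ENNReal.one_ne_top (hadd ▸ le_add_self)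
  refine (ENNReal.add_le_add_iff_right hfin).1 ?_
  rw [hadd, ← measure_univ (μ := μ), ← Set.union_compl_self (W ⁻¹' S)]
  exact (measure_union_le _ _).trans (add_le_add_right (hle Sᶜ) _)

theorem tsum_ofReal_poisson {r : ℝ} (hr : 0 ≤ r) :
    ∑' n : ℕ, ENNReal.ofReal (Real.exp (-r) * r ^ n / (n.factorial : ℝ)) = 1 := by
  lift r to NNReal using hr
  have := hasSum_one_poissonMeasure r
  rw [← ENNReal.ofReal_tsum_of_nonneg (fun n => by positivity) this.summable, this.tsum_eq,
    ENNReal.ofReal_one]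

theorem tsum_ofReal_hypergeometric (m n : ℕ) :
    ∑' k : ℕ, ENNReal.ofReal
      (((m.choose k : ℝ) * (n.choose k : ℝ)) / (((m + n).choose n : ℝ))) = 1 := by
  have hpos : ((m + n).choose n : ℝ) ≠ 0 := by
    exact_mod_cast (Nat.choose_pos (Nat.le_add_left n m)).ne'
  rw [tsum_eq_sum (s := Finset.range (n + 1)) (fun k hk => by
      rw [Nat.choose_eq_zero_of_lt (show n < k by simpa using hk)]; simp),
    ← ENNReal.ofReal_sum_of_nonneg (fun k _ => by positivity), ← Finset.sum_div,
    ENNReal.ofReal_eq_one, div_eq_one_iff_eq hpos, Nat.add_choose_eq,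
    Finset.Nat.sum_antidiagonal_eq_sum_range_succ_mk]
  push_cast
  refine Finset.sum_congr rfl fun k hk => ?_
  rw [Nat.choose_symm (Nat.lt_succ_iff.1 (Finset.mem_range.1 hk))]

theorem poisson_mul_poisson_mul_hypergeometric (α t : ℝ) (m n k : ℕ) :
    (Real.exp (-(α * t)) * (α * t) ^ m / (m.factorial : ℝ)) *
      (Real.exp (-((1 - α) * t)) * ((1 - α) * t) ^ n / (n.factorial : ℝ)) *
      (((m.choose k : ℝ) * (n.choose k : ℝ)) / (((m + n).choose n : ℝ)))
      = auctionWeight α t ((m, n), k) := by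
  have hexp : Real.exp (-t) = Real.exp (-(α * t)) * Real.exp (-((1 - α) * t)) := by
    rw [← Real.exp_add]; congr 1; ring
  have hfact : ((m + n).factorial : ℝ) = (m + n).choose n * m.factorial * n.factorial := by
    have := Nat.add_choose_mul_factorial_mul_factorial m n
    exact_mod_cast this.symm
  have hpos : ((m + n).choose n : ℝ) ≠ 0 := by
    exact_mod_cast (Nat.choose_pos (Nat.le_add_left n m)).ne'
  simp only [auctionWeight]
  rw [hexp, hfact, mul_pow, mul_pow, pow_add]
  field_simp

/-- Lévy continuity for distribution functions: pointwise convergence of the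
characteristic functions gives pointwise convergence of the distribution functions. -/
theorem tendsto_measure_Iic_of_tendsto_charFun {ι : Type*} {l : Filter ι} [l.IsCountablyGenerated]
    {ν : ι → ProbabilityMeasure ℝ} {ν₀ : ProbabilityMeasure ℝ} (x : ℝ)
    (hx : (ν₀ : Measure ℝ) {x} = 0)
    (h : ∀ u, Tendsto (fun i => charFun (ν i : Measure ℝ) u) l (𝓝 (charFun (ν₀ : Measure ℝ) u))) :
    Tendsto (fun i => (ν i : Measure ℝ) (Set.Iic x)) l (𝓝 ((ν₀ : Measure ℝ) (Set.Iic x))) := by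
  refine ProbabilityMeasure.tendsto_measure_of_null_frontier_of_tendsto'
    (tendsto_of_seq_tendsto fun y hy =>
      ProbabilityMeasure.tendsto_of_tendsto_charFun fun u => (h u).comp hy) ?_
  rwa [frontier_Iic]

theorem PMF.charFun_map_toMeasure {ι : Type*} [MeasurableSpace ι] [DiscreteMeasurableSpace ι]
    (q : PMF ι) (g : ι → ℝ) (u : ℝ) :
    charFun (q.toMeasure.map g) u
      = ∑' i, ((q i).toReal : ℂ) * Complex.exp (u * g i * Complex.I) := by
  rw [charFun_apply_real, integral_map Measurable.of_discrete.aemeasurable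
    (by fun_prop), PMF.integral_eq_tsum]
  · simp
  · refine (integrable_const (1 : ℝ)).mono' Measurable.of_discrete.aestronglyMeasurable
      (ae_of_all _ fun i => ?_)
    rw [← Complex.ofReal_mul, Complex.norm_exp_ofReal_mul_I]

/-- Fix `α ∈ (0,1)`.  For each `t > 0`, let `M_t` and `N_t` be independent
Poisson random variables with parameters `αt` and `(1−α)t`, and let `V_t` have conditional
hypergeometric law `P(V_t = k | M_t = m, N_t = n) = C(m,k)C(n,k)/C(m+n,n)`.  Then, as
`t → ∞`, `(V_t − tα(1−α)) / sqrt(tα(1−α)(1 − 2α(1−α)))` converges in distribution to the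
standard normal law (expressed through pointwise convergence of the distribution functions to
the everywhere-continuous standard Gaussian distribution function). -/
theorem stmt_7 {Ω : Type*} [MeasurableSpace Ω] (μ : Measure Ω) [IsProbabilityMeasure μ]
    (α : ℝ) (hα : α ∈ Set.Ioo (0 : ℝ) 1)
    (M N V : ℝ → Ω → ℕ)
    (hM : ∀ t : ℝ, 0 < t → ∀ m : ℕ,
      μ {ω | M t ω = m}
        = ENNReal.ofReal (Real.exp (-(α * t)) * (α * t) ^ m / (m.factorial : ℝ)))
    (hN : ∀ t : ℝ, 0 < t → ∀ n : ℕ,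
      μ {ω | N t ω = n}
        = ENNReal.ofReal (Real.exp (-((1 - α) * t)) * ((1 - α) * t) ^ n / (n.factorial : ℝ)))
    (hindep : ∀ t : ℝ, 0 < t → ∀ m n : ℕ,
      μ {ω | M t ω = m ∧ N t ω = n} = μ {ω | M t ω = m} * μ {ω | N t ω = n})
    (hV : ∀ t : ℝ, 0 < t → ∀ m n k : ℕ,
      μ {ω | V t ω = k ∧ M t ω = m ∧ N t ω = n}
        = μ {ω | M t ω = m ∧ N t ω = n} *
            ENNReal.ofReal (((m.choose k : ℝ) * (n.choose k : ℝ)) / (((m + n).choose n : ℝ)))) :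
    ∀ x : ℝ,
      Tendsto (fun t : ℝ =>
          (μ {ω | ((V t ω : ℝ) - t * (α * (1 - α))) /
              Real.sqrt (t * (α * (1 - α)) * (1 - 2 * (α * (1 - α)))) ≤ x}).toReal)
        atTop (𝓝 ((gaussianReal 0 1 (Set.Iic x)).toReal)) := by
  intro x
  obtain ⟨hα0, hα1⟩ := hα
  set p : ℝ := α * (1 - α) with hp
  have hp0 : 0 < p * (1 - 2 * p) := by
    have : 0 < p := mul_pos hα0 (by linarith)
    have : 0 < 1 - 2 * p := by nlinarith [sq_nonneg (1 - 2 * α)]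
    positivity
  let W : ℝ → Ω → (ℕ × ℕ) × ℕ := fun t ω => ((M t ω, N t ω), V t ω)
  let g : ℝ → (ℕ × ℕ) × ℕ → ℝ := fun t i => ((i.2 : ℝ) - t * p) / Real.sqrt (t * p * (1 - 2 * p))
  have hfiber (t : ℝ) (ht : 0 < t) (m n k : ℕ) : μ (W t ⁻¹' {((m, n), k)}) =
      μ {ω | M t ω = m} * μ {ω | N t ω = n} * ENNReal.ofReal
        (((m.choose k : ℝ) * (n.choose k : ℝ)) / (((m + n).choose n : ℝ))) := by
    rw [← hindep t ht, ← hV t ht]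
    congr 1
    ext ω
    simp only [W, Set.mem_preimage, Set.mem_singleton_iff, Prod.mk.injEq, Set.mem_ofPred_eq]
    tauto
  have hone (t : ℝ) (ht : 0 < t) : ∑' i, μ (W t ⁻¹' {i}) = 1 := by
    simp_rw [ENNReal.tsum_prod', hfiber t ht, ENNReal.tsum_mul_left, tsum_ofReal_hypergeometric,
      mul_one, ENNReal.tsum_mul_left, hM t ht, hN t ht]
    rw [tsum_ofReal_poisson (by nlinarith), ENNReal.tsum_mul_right,
      tsum_ofReal_poisson (by nlinarith), mul_one]
  have hweight (t : ℝ) (ht : 0 < t) (i : (ℕ × ℕ) × ℕ) :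
      (μ (W t ⁻¹' {i})).toReal = auctionWeight α t i := by
    obtain ⟨⟨m, n⟩, k⟩ := i
    have h1 : 0 ≤ α * t := by positivity
    have h2 : 0 ≤ (1 - α) * t := mul_nonneg (by linarith) ht.le
    rw [hfiber t ht, hM t ht, hN t ht, ENNReal.toReal_mul, ENNReal.toReal_mul,
      ENNReal.toReal_ofReal (by positivity), ENNReal.toReal_ofReal (by positivity),
      ENNReal.toReal_ofReal (by positivity), poisson_mul_poisson_mul_hypergeometric]
  have hlaw (t : ℝ) : ∃ ν : ProbabilityMeasure ℝ, 0 < t →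
      (∀ y, (ν : Measure ℝ) (Set.Iic y) = μ {ω | g t (W t ω) ≤ y}) ∧
      ∀ u : ℝ, charFun (ν : Measure ℝ) u
        = ∑' i, (auctionWeight α t i : ℂ) * Complex.exp (u * g t i * Complex.I) := by
    by_cases ht : 0 < t
    · let q : PMF ((ℕ × ℕ) × ℕ) := ⟨fun i => μ (W t ⁻¹' {i}), hone t ht ▸ ENNReal.summable.hasSum⟩
      have hq (i) : q i = μ (W t ⁻¹' {i}) := rfl
      have hg : Measurable (g t) := .of_discrete
      refine ⟨⟨q.toMeasure.map (g t), Measure.isProbabilityMeasure_map hg.aemeasurable⟩,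
        fun _ => ⟨fun y => ?_, fun u => ?_⟩⟩
      · rw [ProbabilityMeasure.coe_mk, Measure.map_apply hg measurableSet_Iic,
          PMF.toMeasure_apply_eq_tsum]
        exact (measure_preimage_eq_tsum (hone t ht) (g t ⁻¹' Set.Iic y)).symm
      · rw [ProbabilityMeasure.coe_mk, PMF.charFun_map_toMeasure]
        simp_rw [hq, hweight t ht]
    · exact ⟨⟨gaussianReal 0 1, inferInstance⟩, fun h => absurd h ht⟩
  choose ν hν using hlaw
  have hchar (u : ℝ) : Tendsto (fun t => charFun (ν t : Measure ℝ) u) atTop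
      (𝓝 (charFun (gaussianReal 0 1) u)) := by
    let θ : ℝ → ℂ := fun t => ((u / Real.sqrt (t * p * (1 - 2 * p)) : ℝ) : ℂ) * Complex.I
    obtain ⟨s, hs, hne, hlim⟩ := exists_roots_tendsto hp0 u (θ := θ) fun t _ => rfl
    have hG : charFun (gaussianReal 0 1) u = Complex.exp (-(u ^ 2 / 2)) := by
      rw [charFun_gaussianReal]; simp
    rw [hG]
    refine hlim.congr' ?_
    filter_upwards [eventually_gt_atTop 0, hne] with t ht hne
    have hsum : Summable (auctionWeight α t) := by
      exact (ENNReal.summable_toReal (by simp [hone t ht])).congr (hweight t ht)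
    have hpgf := sub_mul_tsum_auctionWeight (z := Complex.exp (θ t)) (r := 1 - s t) (s := s t)
      (Complex.norm_exp_ofReal_mul_I _).le hsum (by ring) (by rw [hs, hp]; push_cast; ring)
    rw [(hν t ht).2, ← hpgf, mul_div_cancel_left₀ _ hne, ← tsum_mul_right]
    refine tsum_congr fun i => ?_
    rw [← Complex.exp_nat_mul, mul_assoc, ← Complex.exp_add]
    congr 2
    simp only [g, θ]
    push_cast
    ring
  have : NullSingletonClass (gaussianReal 0 1) := nullSingletonClass_gaussianReal one_ne_zero
  have hIic : Tendsto (fun t => (ν t : Measure ℝ) (Set.Iic x)) atTop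
      (𝓝 (gaussianReal 0 1 (Set.Iic x))) :=
    tendsto_measure_Iic_of_tendsto_charFun (ν₀ := ⟨gaussianReal 0 1, inferInstance⟩) x
      (measure_singleton (μ := gaussianReal 0 1) x) hchar
  refine ((ENNReal.tendsto_toReal (measure_ne_top _ _)).comp hIic).congr' ?_
  filter_upwards [eventually_gt_atTop 0] with t ht
  rw [Function.comp_apply, (hν t ht).1]
end

section
/- Fix α ∈ (0,1). For each integer N ≥ 1, let n_N be a binomial random variable with parameters N and 1−α, and let V_N be a random variable whose conditional law given n_N = n is hypergeometric: P(V_N = k | n_N = n) = C(n,k)C(N−n,k)/C(N,n) for 0 ≤ k ≤ min(n, N−n). Then, as N → ∞, the random variable (V_N − N α(1−α)) / sqrt(N α(1−α)(1 − 3α(1−α))) converges in distribution to the standard normal law N(0,1). -/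
open MeasureTheory ProbabilityTheory Filter Topology

/-- The generating function `∑ₖ C(i,k) C(j,k) uᵏ`. -/
def chooseMulChooseGF {R : Type*} [CommRing R] (u : R) (i j : ℕ) : R :=
  ∑ k ∈ Finset.range (i + 1), (i.choose k : R) * (j.choose k : R) * u ^ k

/-- The generating function of the traded volume among `N` orders, with weight `x` per bid and
weight `y` per ask. -/
def volumeGF {R : Type*} [CommRing R] (x y u : R) (N : ℕ) : R :=
  ∑ p ∈ Finset.HasAntidiagonal.antidiagonal N, x ^ p.1 * y ^ p.2 * chooseMulChooseGF u p.1 p.2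

/-- The weight of the event that the traded volume among `N` orders equals `k`. -/
def volumeWeight {R : Type*} [CommRing R] (x y : R) (N k : ℕ) : R :=
  ∑ p ∈ Finset.HasAntidiagonal.antidiagonal N,
    (p.1.choose k : R) * (p.2.choose k : R) * (x ^ p.1 * y ^ p.2)

section GeneratingFunction

variable {R : Type*} [CommRing R]

lemma chooseMulChooseGF_eq_sum_range (u : R) {i M : ℕ} (j : ℕ) (h : i + 1 ≤ M) :
    chooseMulChooseGF u i j =
      ∑ k ∈ Finset.range M, (i.choose k : R) * (j.choose k : R) * u ^ k := by
  refine Finset.sum_subset (by simpa using h) fun k _ hk ↦ ?_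
  rw [Nat.choose_eq_zero_of_lt (by simpa using hk)]
  simp

@[simp]
lemma chooseMulChooseGF_zero_left (u : R) (j : ℕ) : chooseMulChooseGF u 0 j = 1 := by
  simp [chooseMulChooseGF]

@[simp]
lemma chooseMulChooseGF_zero_right (u : R) (i : ℕ) : chooseMulChooseGF u i 0 = 1 := by
  simp [chooseMulChooseGF, Finset.sum_range_succ']

lemma chooseMulChooseGF_succ_succ (u : R) (i j : ℕ) :
    chooseMulChooseGF u (i + 1) (j + 1) =
      chooseMulChooseGF u (i + 1) j + chooseMulChooseGF u i (j + 1)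
        - (1 - u) * chooseMulChooseGF u i j := by
  have h : chooseMulChooseGF u (i + 1) (j + 1) - chooseMulChooseGF u (i + 1) j
      - chooseMulChooseGF u i (j + 1) + chooseMulChooseGF u i j
      = u * chooseMulChooseGF u i j := by
    rw [chooseMulChooseGF_eq_sum_range u (M := i + 1 + 1) (i := i) (j + 1) (by omega),
      chooseMulChooseGF_eq_sum_range u (M := i + 1 + 1) (i := i + 1) (j + 1) (by omega),
      chooseMulChooseGF_eq_sum_range u (M := i + 1 + 1) (i := i + 1) j (by omega)]
    nth_rw 1 [chooseMulChooseGF_eq_sum_range u (M := i + 1 + 1) (i := i) j (by omega)]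
    rw [chooseMulChooseGF, Finset.mul_sum, ← Finset.sum_sub_distrib, ← Finset.sum_sub_distrib,
      ← Finset.sum_add_distrib, Finset.sum_range_succ']
    simp only [Nat.choose_succ_succ', Nat.choose_zero_right]
    push_cast
    rw [show ((1 : R) * 1 * u ^ 0 - 1 * 1 * u ^ 0 - 1 * 1 * u ^ 0 + 1 * 1 * u ^ 0) = 0 by ring,
      add_zero]
    exact Finset.sum_congr rfl fun k _ ↦ by ring
  linear_combination h

lemma volumeGF_add_two (x y u : R) (N : ℕ) :
    volumeGF x y u (N + 2) =
      (x + y) * volumeGF x y u (N + 1) - x * y * (1 - u) * volumeGF x y u N := by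
  have h2 : volumeGF x y u (N + 2) = y ^ (N + 2) + (x ^ (N + 2) +
      ∑ p ∈ Finset.HasAntidiagonal.antidiagonal N,
        x ^ (p.1 + 1) * y ^ (p.2 + 1) * chooseMulChooseGF u (p.1 + 1) (p.2 + 1)) := by
    rw [volumeGF, Finset.Nat.sum_antidiagonal_succ, Finset.Nat.sum_antidiagonal_succ']
    simp [add_assoc]
  have hx : volumeGF x y u (N + 1) = y ^ (N + 1) +
      ∑ p ∈ Finset.HasAntidiagonal.antidiagonal N,
        x ^ (p.1 + 1) * y ^ p.2 * chooseMulChooseGF u (p.1 + 1) p.2 := by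
    rw [volumeGF, Finset.Nat.sum_antidiagonal_succ]
    simp
  have hy : volumeGF x y u (N + 1) = x ^ (N + 1) +
      ∑ p ∈ Finset.HasAntidiagonal.antidiagonal N,
        x ^ p.1 * y ^ (p.2 + 1) * chooseMulChooseGF u p.1 (p.2 + 1) := by
    rw [volumeGF, Finset.Nat.sum_antidiagonal_succ']
    simp
  have h : ∑ p ∈ Finset.HasAntidiagonal.antidiagonal N,
        x ^ (p.1 + 1) * y ^ (p.2 + 1) * chooseMulChooseGF u (p.1 + 1) (p.2 + 1) =
      y * (∑ p ∈ Finset.HasAntidiagonal.antidiagonal N,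
        x ^ (p.1 + 1) * y ^ p.2 * chooseMulChooseGF u (p.1 + 1) p.2) +
      x * (∑ p ∈ Finset.HasAntidiagonal.antidiagonal N,
        x ^ p.1 * y ^ (p.2 + 1) * chooseMulChooseGF u p.1 (p.2 + 1))
      - x * y * (1 - u) * volumeGF x y u N := by
    rw [volumeGF, Finset.mul_sum, Finset.mul_sum, Finset.mul_sum, ← Finset.sum_add_distrib,
      ← Finset.sum_sub_distrib]
    refine Finset.sum_congr rfl fun p _ ↦ ?_
    rw [chooseMulChooseGF_succ_succ]
    ring
  rw [h2, h]
  linear_combination (-y) * hx - x * hy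

@[simp]
lemma volumeGF_zero (x y u : R) : volumeGF x y u 0 = 1 := by
  simp [volumeGF]

@[simp]
lemma volumeGF_one (x y u : R) : volumeGF x y u 1 = x + y := by
  simp [volumeGF, Finset.Nat.antidiagonal_succ, add_comm]

lemma sub_mul_volumeGF {x y u r s : R} (hxy : x + y = 1) (hrs : r + s = 1)
    (hmul : r * s = x * y * (1 - u)) (N : ℕ) :
    (r - s) * volumeGF x y u N = r ^ (N + 1) - s ^ (N + 1) := by
  induction N using Nat.twoStepInduction with
  | zero => simp
  | one => simp only [volumeGF_one, hxy]; linear_combination (s - r) * hrs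
  | more n h₁ h₂ =>
    rw [volumeGF_add_two, hxy, ← hmul]
    linear_combination h₂ - r * s * h₁ + (s ^ (n + 2) - r ^ (n + 2)) * hrs

lemma volumeGF_eq_one {x y : R} (hxy : x + y = 1) (N : ℕ) : volumeGF x y 1 N = 1 := by
  simpa using sub_mul_volumeGF (u := 1) (r := 1) (s := 0) hxy (by simp) (by simp) N

lemma sum_volumeWeight_mul_pow (x y u : R) (N : ℕ) :
    ∑ k ∈ Finset.range (N + 1), volumeWeight x y N k * u ^ k = volumeGF x y u N := by
  simp_rw [volumeWeight, volumeGF, Finset.sum_mul]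
  rw [Finset.sum_comm]
  refine Finset.sum_congr rfl fun p hp ↦ ?_
  rw [chooseMulChooseGF_eq_sum_range u (M := N + 1) p.2
    (by have := Finset.HasAntidiagonal.mem_antidiagonal.1 hp; omega), Finset.mul_sum]
  exact Finset.sum_congr rfl fun k _ ↦ by ring

end GeneratingFunction

section Asymptotics

open Complex

lemma Continuous.tendsto_nhdsNE {f : ℝ → ℂ} (hf : Continuous f) {a : ℝ} {z : ℂ} (h : f a = z) :
    Tendsto f (𝓝[≠] a) (𝓝 z) :=
  (hf.tendsto' a z h).mono_left nhdsWithin_le_nhds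

lemma tendsto_exp_sub_one_sub_div_sq (x : ℂ) :
    Tendsto (fun ε : ℝ ↦ (exp (x * ε) - 1 - x * ε) / (ε : ℂ) ^ 2) (𝓝[≠] 0) (𝓝 (x ^ 2 / 2)) := by
  have h0 : Tendsto (fun ε : ℝ ↦ x * (ε : ℂ)) (𝓝[≠] 0) (𝓝 0) :=
    Continuous.tendsto_nhdsNE (by fun_prop) (by simp)
  have h := (exp_sub_sum_range_succ_isLittleO_pow 2).comp_tendsto h0
  have h' : (fun ε : ℝ ↦ exp (x * ε) - 1 - x * ε - x ^ 2 / 2 * ε ^ 2)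
      =o[𝓝[≠] 0] fun ε : ℝ ↦ (ε : ℂ) ^ 2 := by
    refine Asymptotics.IsLittleO.trans_isBigO (h.congr_left fun ε ↦ ?_)
      (.of_bound (‖x‖ ^ 2) (.of_forall fun ε ↦ ?_))
    · simp [Finset.sum_range_succ, mul_pow]
      ring
    · simp [mul_pow]
  refine (zero_add (x ^ 2 / 2) ▸ h'.tendsto_div_nhds_zero.add_const (x ^ 2 / 2)).congr' ?_
  filter_upwards [self_mem_nhdsWithin] with ε hε
  have : (ε : ℂ) ≠ 0 := by exact_mod_cast hε
  field_simp
  ring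

lemma tendsto_ofReal_nhdsNE_zero : Tendsto (fun ε : ℝ ↦ (ε : ℂ)) (𝓝[≠] 0) (𝓝 0) :=
  continuous_ofReal.tendsto_nhdsNE (by simp)

lemma tendsto_exp_sub_one_div (x : ℂ) :
    Tendsto (fun ε : ℝ ↦ (exp (x * ε) - 1) / (ε : ℂ)) (𝓝[≠] 0) (𝓝 x) := by
  have h := ((tendsto_exp_sub_one_sub_div_sq x).mul tendsto_ofReal_nhdsNE_zero).add_const x
  rw [mul_zero, zero_add] at h
  refine h.congr' ?_
  filter_upwards [self_mem_nhdsWithin] with ε hε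
  have : (ε : ℂ) ≠ 0 := by exact_mod_cast hε
  field_simp
  ring

/-- The root of `z * (1 - z) = c` that tends to `0` with `c`. -/
noncomputable def smallRoot (c : ℂ) : ℂ := (1 - (1 - 4 * c) ^ (1 / 2 : ℂ)) / 2

lemma smallRoot_mul_one_sub (c : ℂ) : (1 - smallRoot c) * smallRoot c = c := by
  have h : ((1 - 4 * c) ^ (1 / 2 : ℂ)) ^ 2 = 1 - 4 * c := by
    simp
  rw [smallRoot]
  linear_combination (-1 / 4) * h

lemma tendsto_smallRoot : Tendsto smallRoot (𝓝 0) (𝓝 0) := by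
  have h : ContinuousAt smallRoot 0 := by
    unfold smallRoot
    refine (continuousAt_const.sub
      (ContinuousAt.cpow (by fun_prop) continuousAt_const ?_)).div_const _
    simp
  simpa [ContinuousAt, smallRoot] using h

lemma tendsto_exp_mul_one_sub_smallRoot (p : ℝ) :
    Tendsto (fun ε : ℝ ↦ (exp (-(p * I) * ε) * (1 - smallRoot (p * (1 - exp (I * ε)))) - 1)
      / (ε : ℂ) ^ 2) (𝓝[≠] 0) (𝓝 ((3 * (p : ℂ) ^ 2 - p) / 2)) := by
  set s : ℝ → ℂ := fun ε ↦ smallRoot (p * (1 - exp (I * ε))) with hs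
  have hc0 : Tendsto (fun ε : ℝ ↦ (p : ℂ) * (1 - exp (I * ε))) (𝓝[≠] 0) (𝓝 0) :=
    Continuous.tendsto_nhdsNE (by fun_prop) (by simp)
  have hs0 : Tendsto s (𝓝[≠] 0) (𝓝 0) := tendsto_smallRoot.comp hc0
  have hmul : ∀ ε : ℝ, (1 - s ε) * s ε = p * (1 - exp (I * ε)) :=
    fun ε ↦ smallRoot_mul_one_sub _
  have hs1 : Tendsto (fun ε ↦ s ε / (ε : ℂ)) (𝓝[≠] 0) (𝓝 (-(p * I))) := by
    have h1 : Tendsto (fun ε ↦ 1 - s ε) (𝓝[≠] 0) (𝓝 1) := by simpa using hs0.const_sub 1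
    have h := ((tendsto_exp_sub_one_div I).const_mul (-(p : ℂ))).div h1 one_ne_zero
    rw [div_one, neg_mul] at h
    refine h.congr' ?_
    filter_upwards [h1.eventually_ne one_ne_zero] with ε hε
    simp only [Pi.div_apply]
    rw [div_eq_iff hε]
    linear_combination (-(ε : ℂ)⁻¹) * hmul ε
  have hexp : Tendsto (fun ε : ℝ ↦ exp (-(p * I) * ε)) (𝓝[≠] 0) (𝓝 1) :=
    Continuous.tendsto_nhdsNE (by fun_prop) (by simp)
  have h := (((tendsto_exp_sub_one_sub_div_sq (-(p * I))).add
    ((tendsto_exp_sub_one_sub_div_sq I).const_mul (p : ℂ))).add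
    (((tendsto_exp_sub_one_div I).const_mul (p : ℂ)).mul
      (tendsto_exp_sub_one_div (-(p * I))))).sub (hexp.mul (hs1.pow 2))
  have hlim : (-((p : ℂ) * I)) ^ 2 / 2 + p * (I ^ 2 / 2) + p * I * -(p * I)
      - 1 * (-(p * I)) ^ 2 = (3 * p ^ 2 - p) / 2 := by
    linear_combination (-3 / 2 * p ^ 2 + p / 2 : ℂ) * I_sq
  rw [hlim] at h
  refine h.congr' ?_
  filter_upwards [self_mem_nhdsWithin] with ε hε
  have : (ε : ℂ) ≠ 0 := by exact_mod_cast hε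
  generalize exp (-(p * I) * ε) = E
  field_simp
  linear_combination E * hmul ε

lemma tendsto_exp_pow_mul_root_pow_sub_div (p : ℝ) {L : ℂ} {τ : ℕ → ℝ}
    (hτ : Tendsto τ atTop (𝓝[≠] 0))
    (hL : Tendsto (fun N : ℕ ↦ (N : ℂ) * (τ N : ℂ) ^ 2) atTop (𝓝 L))
    {φ : ℕ → ℂ}
    (hφ : ∀ N, ∀ r s : ℂ, r + s = 1 → r * s = p * (1 - exp (I * τ N)) →
      (r - s) * φ N = r ^ (N + 1) - s ^ (N + 1)) :
    Tendsto (fun N ↦ exp (-(p * I) * τ N) ^ N * φ N) atTop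
      (𝓝 (exp (L * ((3 * (p : ℂ) ^ 2 - p) / 2)))) := by
  set s : ℕ → ℂ := fun N ↦ smallRoot (p * (1 - exp (I * τ N))) with hs
  set e : ℕ → ℂ := fun N ↦ exp (-(p * I) * τ N) with he
  have hτ0 : Tendsto τ atTop (𝓝 0) := hτ.mono_right nhdsWithin_le_nhds
  have hs0 : Tendsto s atTop (𝓝 0) := by
    refine tendsto_smallRoot.comp (Tendsto.comp (g := fun ε : ℝ ↦ (p : ℂ) * (1 - exp (I * ε)))
      (Continuous.tendsto' (by fun_prop) _ _ (by simp)) hτ0)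
  have hr : Tendsto (fun N ↦ 1 - s N) atTop (𝓝 1) := by simpa using hs0.const_sub 1
  have hrs : Tendsto (fun N ↦ 1 - s N - s N) atTop (𝓝 1) := by simpa using hr.sub hs0
  have hmain : Tendsto (fun N ↦ (e N * (1 - s N)) ^ N) atTop
      (𝓝 (exp (L * ((3 * (p : ℂ) ^ 2 - p) / 2)))) := by
    have h := tendsto_one_add_pow_exp_of_tendsto (g := fun N ↦ e N * (1 - s N) - 1)
      (t := L * ((3 * p ^ 2 - p) / 2)) ?_
    · simpa using h
    refine (hL.mul ((tendsto_exp_mul_one_sub_smallRoot p).comp hτ)).congr' ?_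
    filter_upwards [hτ.eventually self_mem_nhdsWithin] with N hN
    have : (τ N : ℂ) ≠ 0 := by exact_mod_cast hN
    simp only [Function.comp_apply, he, hs]
    field_simp
  have hsmall : Tendsto (fun N ↦ e N ^ N * s N ^ (N + 1)) atTop (𝓝 0) := by
    have hen : ∀ N, ‖e N‖ = 1 := fun N ↦ by
      simp only [he]
      rw [show -((p : ℂ) * I) * τ N = ((-(p * τ N) : ℝ) : ℂ) * I by push_cast; ring]
      exact norm_exp_ofReal_mul_I _
    refine squeeze_zero_norm' ?_ (tendsto_norm_zero.comp hs0)
    filter_upwards [(tendsto_norm_zero.comp hs0).eventually_le_const one_pos] with N hN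
    simp only [norm_mul, norm_pow, hen, one_pow, one_mul, Function.comp_apply] at hN ⊢
    exact pow_le_of_le_one (norm_nonneg _) hN (by simp)
  have h := ((hmain.mul hr).sub hsmall).div hrs one_ne_zero
  rw [mul_one, sub_zero, div_one] at h
  refine h.congr' ?_
  filter_upwards [hrs.eventually_ne one_ne_zero] with N hN
  simp only [Pi.div_apply]
  rw [div_eq_iff hN]
  have := hφ N (1 - s N) (s N) (by ring) (smallRoot_mul_one_sub _)
  rw [mul_pow]
  linear_combination (-(e N) ^ N) * this

end Asymptotics

section Law

/-- If the fibres of `X` have outer measure at most that of the atoms of a probability measure `ρ`,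
then `ρ` is the law of `X`, even without any measurability of `X`. -/
lemma measure_preimage_eq_of_forall_measure_fiber_le {Ω : Type*} [MeasurableSpace Ω]
    {μ : Measure Ω} [IsProbabilityMeasure μ] {ρ : Measure ℕ} [IsProbabilityMeasure ρ] {X : Ω → ℕ}
    (h : ∀ k, μ (X ⁻¹' {k}) ≤ ρ {k}) (S : Set ℕ) : μ (X ⁻¹' S) = ρ S := by
  have hle : ∀ T : Set ℕ, μ (X ⁻¹' T) ≤ ρ T := fun T ↦ by
    calc μ (X ⁻¹' T) = μ (⋃ k ∈ T, X ⁻¹' {k}) := by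
          rw [← Set.preimage_iUnion₂, Set.biUnion_of_singleton]
      _ ≤ ∑' k : T, μ (X ⁻¹' {k.1}) := measure_biUnion_le μ T.to_countable _
      _ ≤ ∑' k : T, ρ {k.1} := ENNReal.tsum_le_tsum fun k ↦ h k
      _ = ρ T := by
          rw [← measure_biUnion T.to_countable (fun i _ j _ hij ↦ by simpa using hij)
            (fun _ _ ↦ MeasurableSet.of_discrete), Set.biUnion_of_singleton]
  refine le_antisymm (hle S) ?_
  have h1 : ρ S + ρ Sᶜ = 1 := by
    rw [measure_add_measure_compl MeasurableSet.of_discrete, measure_univ]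
  have h2 : 1 ≤ μ (X ⁻¹' S) + ρ Sᶜ := by
    calc 1 = μ (X ⁻¹' S ∪ X ⁻¹' Sᶜ) := by
          rw [← Set.preimage_union, Set.union_compl_self, Set.preimage_univ, measure_univ]
      _ ≤ μ (X ⁻¹' S) + μ (X ⁻¹' Sᶜ) := measure_union_le _ _
      _ ≤ μ (X ⁻¹' S) + ρ Sᶜ := by gcongr; exact hle _
  exact (ENNReal.add_le_add_iff_right (measure_ne_top ρ Sᶜ)).1 (h1 ▸ h2)

/-- The law of the traded volume among `N` orders, with weight `x` per bid and `y` per ask. -/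
noncomputable def volumeLaw (x y : ℝ) (N : ℕ) : Measure ℕ :=
  ∑ k ∈ Finset.range (N + 1), ENNReal.ofReal (volumeWeight x y N k) • Measure.dirac k

lemma volumeWeight_nonneg {x y : ℝ} (hx : 0 ≤ x) (hy : 0 ≤ y) (N k : ℕ) :
    0 ≤ volumeWeight x y N k :=
  Finset.sum_nonneg fun _ _ ↦ by positivity

lemma isProbabilityMeasure_volumeLaw {x y : ℝ} (hx : 0 ≤ x) (hy : 0 ≤ y) (hxy : x + y = 1)
    (N : ℕ) : IsProbabilityMeasure (volumeLaw x y N) where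
  measure_univ := by
    have h := sum_volumeWeight_mul_pow x y 1 N
    simp only [one_pow, mul_one, volumeGF_eq_one hxy] at h
    simp [volumeLaw, ← ENNReal.ofReal_sum_of_nonneg fun k _ ↦ volumeWeight_nonneg hx hy N k, h]

lemma volumeLaw_singleton {x y : ℝ} (N k : ℕ) :
    volumeLaw x y N {k} = ENNReal.ofReal (volumeWeight x y N k) := by
  have h : N < k → volumeWeight x y N k = 0 := fun hk ↦ Finset.sum_eq_zero fun p hp ↦ by
    have := Finset.HasAntidiagonal.mem_antidiagonal.1 hp
    rw [Nat.choose_eq_zero_of_lt (n := p.1) (by omega)]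
    simp
  simp only [volumeLaw, Measure.coe_finsetSum, Measure.coe_smul, Finset.sum_apply, Pi.smul_apply,
    smul_eq_mul, MeasurableSet.singleton, Measure.dirac_apply']
  rw [Finset.sum_eq_single k]
  · simp
  · intro j _ hj
    simp [hj]
  · intro hk
    simp [h (by simpa using hk)]

lemma charFun_map_volumeLaw {x y : ℝ} (hx : 0 ≤ x) (hy : 0 ≤ y) (N : ℕ) (m b t : ℝ) :
    charFun ((volumeLaw x y N).map fun k : ℕ ↦ ((k : ℝ) - N * m) / b) t =
      Complex.exp (-(m * Complex.I) * (t / b : ℝ)) ^ N *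
        volumeGF (x : ℂ) y (Complex.exp (Complex.I * (t / b : ℝ))) N := by
  rw [charFun_apply_real, integral_map (by fun_prop) (by fun_prop), volumeLaw,
    integral_finsetSum_measure, ← sum_volumeWeight_mul_pow, Finset.mul_sum]
  · refine Finset.sum_congr rfl fun k _ ↦ ?_
    rw [integral_smul_measure, integral_dirac,
      ENNReal.toReal_ofReal (volumeWeight_nonneg hx hy N k), Complex.real_smul, ← Complex.exp_nat_mul,
      ← Complex.exp_nat_mul, mul_left_comm, ← Complex.exp_add]
    congr 1
    · simp [volumeWeight]
    · congr 1
      push_cast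
      ring
  · intro k _
    exact (integrable_dirac (by simp)).smul_measure ENNReal.ofReal_ne_top

lemma tendsto_charFun_map_volumeLaw {α : ℝ} (hα : α ∈ Set.Ioo (0 : ℝ) 1) (t : ℝ) :
    Tendsto (fun N : ℕ ↦ charFun ((volumeLaw (1 - α) α N).map fun k : ℕ ↦
        ((k : ℝ) - N * (α * (1 - α))) / √(N * (α * (1 - α)) * (1 - 3 * (α * (1 - α))))) t) atTop
      (𝓝 (charFun (gaussianReal 0 1) t)) := by
  obtain ⟨h0, h1⟩ := hα
  have hx : 0 ≤ 1 - α := by linarith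
  set p := α * (1 - α) with hp
  have hp0 : 0 < p := mul_pos h0 (by linarith)
  have hp1 : 0 < 1 - 3 * p := by nlinarith [sq_nonneg (2 * α - 1)]
  rcases eq_or_ne t 0 with rfl | ht
  · have := fun N ↦ isProbabilityMeasure_volumeLaw hx h0.le (by ring) N
    have hmap := fun (N : ℕ) ↦ Measure.isProbabilityMeasure_map (μ := volumeLaw (1 - α) α N)
      (f := fun k : ℕ ↦ ((k : ℝ) - N * p) / √(N * p * (1 - 3 * p))) (by fun_prop)
    simp
  simp only [charFun_map_volumeLaw hx h0.le, charFun_gaussianReal]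
  have hb : Tendsto (fun N : ℕ ↦ √(N * p * (1 - 3 * p))) atTop atTop :=
    Real.tendsto_sqrt_atTop.comp
      ((tendsto_natCast_atTop_atTop.atTop_mul_const hp0).atTop_mul_const hp1)
  have hτ : Tendsto (fun N : ℕ ↦ t / √(N * p * (1 - 3 * p))) atTop (𝓝[≠] 0) := by
    refine tendsto_nhdsWithin_iff.2 ⟨hb.const_div_atTop t, ?_⟩
    filter_upwards [hb.eventually_gt_atTop 0] with N hN
    exact div_ne_zero ht hN.ne'
  have hL : Tendsto (fun N : ℕ ↦ (N : ℂ) * ((t / √(N * p * (1 - 3 * p)) : ℝ) : ℂ) ^ 2) atTop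
      (𝓝 ((t ^ 2 / (p * (1 - 3 * p)) : ℝ) : ℂ)) := by
    refine tendsto_const_nhds.congr' ?_
    filter_upwards [eventually_gt_atTop 0] with N hN
    have hN' : (0 : ℝ) < N := by exact_mod_cast hN
    have h : N * (t / √(N * p * (1 - 3 * p))) ^ 2 = t ^ 2 / (p * (1 - 3 * p)) := by
      rw [div_pow, Real.sq_sqrt (by positivity)]
      field_simp
    exact_mod_cast h.symm
  convert! tendsto_exp_pow_mul_root_pow_sub_div p hτ hL (φ := fun N ↦ volumeGF ((1 - α : ℝ) : ℂ) α
    (Complex.exp (Complex.I * (t / √(N * p * (1 - 3 * p)) : ℝ))) N) ?_ using 3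
  · have h : -(t ^ 2 / 2) = t ^ 2 / (p * (1 - 3 * p)) * ((3 * p ^ 2 - p) / 2) := by
      have hq := (mul_pos hp0 hp1).ne'
      rw [show 3 * p ^ 2 - p = -(p * (1 - 3 * p)) by ring]
      generalize p * (1 - 3 * p) = q at hq
      field_simp
    simp only [Complex.ofReal_zero, mul_zero, zero_mul, NNReal.coe_one, Complex.ofReal_one, one_mul,
      zero_sub]
    exact_mod_cast congrArg Complex.ofReal h
  · intro N r s hrs hmul
    refine sub_mul_volumeGF (by push_cast; ring) hrs ?_ N
    rw [hmul, hp]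
    push_cast
    ring

end Law

/-- Fix `α ∈ (0,1)`.  For each `N ≥ 1`, let `n_N` be binomial with
parameters `N` and `1−α`, and let `V_N` have conditional hypergeometric law
`P(V_N = k | n_N = n) = C(n,k)C(N−n,k)/C(N,n)`.  Then, as `N → ∞`,
`(V_N − Nα(1−α)) / sqrt(Nα(1−α)(1 − 3α(1−α)))` converges in distribution to the standard
normal law (expressed through pointwise convergence of the distribution functions to the
everywhere-continuous standard Gaussian distribution function). -/
theorem stmt_8 {Ω : Type*} [MeasurableSpace Ω] (μ : Measure Ω) [IsProbabilityMeasure μ]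
    (α : ℝ) (hα : α ∈ Set.Ioo (0 : ℝ) 1)
    (nn V : ℕ → Ω → ℕ)
    (hnn : ∀ N : ℕ, 1 ≤ N → ∀ j : ℕ,
      μ {ω | nn N ω = j}
        = ENNReal.ofReal ((N.choose j : ℝ) * (1 - α) ^ j * α ^ (N - j)))
    (hV : ∀ N : ℕ, 1 ≤ N → ∀ n k : ℕ,
      μ {ω | V N ω = k ∧ nn N ω = n}
        = μ {ω | nn N ω = n} *
            ENNReal.ofReal (((n.choose k : ℝ) * ((N - n).choose k : ℝ)) / ((N.choose n : ℝ)))) :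
    ∀ x : ℝ,
      Tendsto (fun N : ℕ =>
          (μ {ω | ((V N ω : ℝ) - (N : ℝ) * (α * (1 - α))) /
              Real.sqrt ((N : ℝ) * (α * (1 - α)) * (1 - 3 * (α * (1 - α)))) ≤ x}).toReal)
        atTop (𝓝 ((gaussianReal 0 1 (Set.Iic x)).toReal)) := by
  intro x
  obtain ⟨h0, h1⟩ := id hα
  have hx : 0 ≤ 1 - α := by linarith
  have := fun N ↦ isProbabilityMeasure_volumeLaw hx h0.le (by ring) N
  have hfiber : ∀ N, 1 ≤ N → ∀ k, μ (V N ⁻¹' {k}) ≤ volumeLaw (1 - α) α N {k} := by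
    intro N hN k
    have hjoint : ∀ n, μ {ω | V N ω = k ∧ nn N ω = n} = ENNReal.ofReal
        ((n.choose k : ℝ) * ((N - n).choose k : ℝ) * ((1 - α) ^ n * α ^ (N - n)) *
          if n ≤ N then 1 else 0) := by
      intro n
      rw [hV N hN, hnn N hN, ← ENNReal.ofReal_mul (by positivity)]
      congr 1
      split_ifs with hn
      · have : (N.choose n : ℝ) ≠ 0 := by exact_mod_cast (Nat.choose_pos hn).ne'
        field_simp
      · rw [Nat.choose_eq_zero_of_lt (not_le.1 hn)]
        simp
    calc μ (V N ⁻¹' {k}) ≤ μ (⋃ n, {ω | V N ω = k ∧ nn N ω = n}) :=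
          measure_mono fun ω hω ↦ Set.mem_iUnion.2 ⟨nn N ω, hω, rfl⟩
      _ ≤ ∑' n, μ {ω | V N ω = k ∧ nn N ω = n} := measure_iUnion_le _
      _ = ∑ n ∈ Finset.range (N + 1), μ {ω | V N ω = k ∧ nn N ω = n} :=
          tsum_eq_sum fun n hn ↦ by
            rw [hjoint, if_neg (by simpa [Nat.lt_succ_iff] using hn)]
            simp
      _ = volumeLaw (1 - α) α N {k} := by
          rw [volumeLaw_singleton, volumeWeight, Finset.Nat.sum_antidiagonal_eq_sum_range_succ_mk,
            ENNReal.ofReal_sum_of_nonneg fun _ _ ↦ by positivity]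
          refine Finset.sum_congr rfl fun n hn ↦ ?_
          rw [hjoint, if_pos (by simpa [Nat.lt_succ_iff] using hn), mul_one]
  have hmeas : ∀ N : ℕ, Measurable fun k : ℕ ↦
      ((k : ℝ) - N * (α * (1 - α))) / √(N * (α * (1 - α)) * (1 - 3 * (α * (1 - α)))) :=
    fun N ↦ measurable_of_countable _
  let ν : ℕ → ProbabilityMeasure ℝ := fun N ↦
    ⟨(volumeLaw (1 - α) α N).map _, Measure.isProbabilityMeasure_map (hmeas N).aemeasurable⟩
  have hν : Tendsto ν atTop (𝓝 ⟨gaussianReal 0 1, inferInstance⟩) :=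
    ProbabilityMeasure.tendsto_of_tendsto_charFun fun t ↦ tendsto_charFun_map_volumeLaw hα t
  have hcdf := ProbabilityMeasure.tendsto_measure_of_null_frontier_of_tendsto' hν (E := Set.Iic x)
    (by
      have := nullSingletonClass_gaussianReal (μ := 0) (v := 1) one_ne_zero
      simp)
  refine ((ENNReal.tendsto_toReal (measure_ne_top (gaussianReal 0 1) _)).comp hcdf).congr' ?_
  filter_upwards [eventually_ge_atTop 1] with N hN
  simp only [Function.comp_apply, ν, ProbabilityMeasure.coe_mk]
  rw [Measure.map_apply (hmeas N) measurableSet_Iic,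
    ← measure_preimage_eq_of_forall_measure_fiber_le (hfiber N hN)]
  rfl
end

section
/- Fix α ∈ (0,1) and let F be an absolutely continuous probability distribution on ℝ with density f, with f continuous and strictly positive at the quantile q = F^{-1}(1−α). For each t > 0, let M_t, N_t be independent Poisson random variables with parameters αt and (1−α)t, and conditionally on M_t = m ≥ 1, N_t = n ≥ 1, let L_t be distributed as the n-th order statistic of an i.i.d. sample of size n+m from F. Then, as t → ∞, the conditional law of sqrt(t) · f(q) · (L_t − q) / sqrt(2α(1−α)) given {M_t ≥ 1, N_t ≥ 1} converges weakly to the standard normal law N(0,1). The same limit holds when L_t is replaced by the upper bound U_t, distributed conditionally as the (n+1)-th order statistic of the pooled (n+m)-sample. -/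
open MeasureTheory ProbabilityTheory Filter Topology
open scoped NNReal ENNReal unitInterval

/-- The probability generating function of a Poisson law. -/
lemma integral_pow_poissonMeasure (r : ℝ≥0) (z : ℂ) :
    ∫ n, z ^ n ∂(poissonMeasure r) = Complex.exp (r * (z - 1)) := by
  rw [integral_poissonMeasure]
  have h := (NormedSpace.expSeries_div_hasSum_exp ((r : ℂ) * z)).mul_left (Complex.exp (-r))
  rw [← Complex.exp_eq_exp_ℂ, ← Complex.exp_add] at h
  convert h.tsum_eq using 1
  · refine tsum_congr fun n => ?_
    rw [Complex.real_smul]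
    push_cast
    rw [mul_pow]; ring
  · congr 1; ring

/-- The probability generating function of a binomial law. -/
lemma integral_pow_binomial (n : ℕ) (p : I) (z : ℂ) :
    ∫ j, z ^ j ∂(binomial n p) = (1 - (p : ℝ) + (p : ℝ) * z) ^ n := by
  rw [integral_binomial, add_comm, add_pow, ← Nat.range_succ_eq_Iic]
  refine Finset.sum_congr rfl fun j _ => ?_
  rw [Complex.real_smul]
  push_cast
  rw [mul_pow]; ring

/-- The fibres of a map to a countable type are null measurable as soon as their outer measures add
up to the total mass. -/
lemma nullMeasurableSet_fiber {Ω ι : Type*} [MeasurableSpace Ω] [Countable ι] (μ : Measure Ω)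
    [IsProbabilityMeasure μ] (Z : Ω → ι) (hZ : ∑' i, μ (Z ⁻¹' {i}) = 1) (i : ι) :
    NullMeasurableSet (Z ⁻¹' {i}) μ := by
  classical
  set B := fun i => toMeasurable μ (Z ⁻¹' {i}) with hB
  have hBm : ∀ i, MeasurableSet (B i) := fun i => measurableSet_toMeasurable _ _
  set C := ⋃ k : {k // k ≠ i}, B k with hC
  have hCm : MeasurableSet C := MeasurableSet.iUnion fun k => hBm k
  have hsub : Cᶜ ⊆ Z ⁻¹' {i} := by
    intro ω hω
    by_contra h
    exact hω (Set.mem_iUnion.2 ⟨⟨Z ω, h⟩, subset_toMeasurable _ _ rfl⟩)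
  have hCle : μ C ≤ ∑' k : {k // k ≠ i}, μ (Z ⁻¹' {k.1}) := by
    refine (measure_iUnion_le _).trans_eq ?_
    simp [hB, measure_toMeasurable]
  have hsum : μ (Z ⁻¹' {i}) + ∑' k : {k // k ≠ i}, μ (Z ⁻¹' {k.1}) = 1 := by
    rw [← hZ, ← ENNReal.summable.tsum_add_tsum_compl (s := {i}) ENNReal.summable]
    simp [Set.compl_singleton_eq]
    rfl
  have hle : μ (B i) ≤ μ Cᶜ := by
    rw [hB, measure_toMeasurable, prob_compl_eq_one_sub hCm]
    refine ENNReal.le_sub_of_add_le_right (measure_ne_top _ _) ?_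
    rw [← hsum]
    gcongr
  have hsub' : Cᶜ ⊆ B i := hsub.trans (subset_toMeasurable _ _)
  have hae : (Cᶜ : Set Ω) =ᵐ[μ] B i :=
    ae_eq_of_subset_of_measure_ge hsub' hle hCm.compl.nullMeasurableSet (measure_ne_top _ _)
  have : (Z ⁻¹' {i} : Set Ω) =ᵐ[μ] B i :=
    (subset_toMeasurable _ _).eventuallyLE.antisymm (hae.symm.le.trans hsub.eventuallyLE)
  exact (hBm i).nullMeasurableSet.congr this.symm

/-- Decomposition of the outer measure of an arbitrary set along the fibres of such a map. -/
lemma measure_eq_tsum_inter_fiber {Ω ι : Type*} [MeasurableSpace Ω] [Countable ι] (μ : Measure Ω)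
    [IsProbabilityMeasure μ] (Z : Ω → ι) (hZ : ∑' i, μ (Z ⁻¹' {i}) = 1) (E : Set Ω) :
    μ E = ∑' i, μ (E ∩ Z ⁻¹' {i}) := by
  have hm := nullMeasurableSet_fiber μ Z hZ
  have hd : Pairwise (Function.onFun (AEDisjoint μ) fun i => Z ⁻¹' {i}) := fun i j hij =>
    (Disjoint.preimage Z (by simpa using hij)).aedisjoint
  have h := Measure.restrict_iUnion_ae hd hm
  have hU : (⋃ i, Z ⁻¹' {i}) = Set.univ := by ext; simp
  rw [hU, Measure.restrict_univ] at h
  conv_lhs => rw [h]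
  rw [Measure.sum_apply_of_countable]
  exact tsum_congr fun i => Measure.restrict_apply₀' (hm i)

/-- The binomial tail as an incomplete beta integral. -/
lemma binomial_real_tail (k r : ℕ) (p : I) :
    (binomial (k + r + 1) p).real {j | k + 1 ≤ j} =
      ∫ x in (0 : ℝ)..p,
        (((k + r + 1).factorial : ℝ) / ((k.factorial : ℝ) * (r.factorial : ℝ))) * x ^ k *
          (1 - x) ^ r := by
  set P : Polynomial ℝ :=
    ∑ j ∈ Finset.range (r + 1), bernsteinPolynomial ℝ (k + r + 1) (k + j + 1) with hP
  have hder : P.derivative = ((k + r + 1 : ℕ) : Polynomial ℝ) * bernsteinPolynomial ℝ (k + r) k := by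
    simp_rw [hP, Polynomial.derivative_sum, bernsteinPolynomial.derivative_succ, ← Finset.mul_sum]
    congr 1
    have := Finset.sum_range_sub' (fun j => bernsteinPolynomial ℝ (k + r) (k + j)) (r + 1)
    simp only [add_zero, ← add_assoc] at this
    simp only [Nat.add_sub_cancel, this]
    rw [bernsteinPolynomial.eq_zero_of_lt (n := k + r) (ν := k + r + 1) ℝ (by lia), sub_zero]
  have hint : ∫ x in (0 : ℝ)..p,
        (((k + r + 1).factorial : ℝ) / ((k.factorial : ℝ) * (r.factorial : ℝ))) * x ^ k *
          (1 - x) ^ r = P.eval (p : ℝ) - P.eval 0 := by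
    refine intervalIntegral.integral_eq_sub_of_hasDerivAt (f := fun x => P.eval x)
      (fun x _ => ?_) (Continuous.intervalIntegrable (by fun_prop) _ _)
    refine (P.hasDerivAt x).congr_deriv ?_
    rw [hder, bernsteinPolynomial]
    simp only [Polynomial.eval_mul, Polynomial.eval_natCast, Polynomial.eval_pow,
      Polynomial.eval_X, Polynomial.eval_sub, Polynomial.eval_one, Nat.add_sub_cancel_left]
    rw [Nat.cast_add_choose ℝ, Nat.factorial_succ]
    push_cast
    ring
  have h0 : P.eval 0 = 0 := by
    simp [hP, Polynomial.eval_finsetSum, bernsteinPolynomial.eval_at_0]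
  rw [hint, h0, sub_zero, ← integral_indicator_one (by measurability), integral_binomial,
    ← Nat.range_succ_eq_Iic, show k + r + 1 + 1 = (k + 1) + (r + 1) by lia,
    Finset.sum_range_add, Finset.sum_eq_zero, zero_add, hP, Polynomial.eval_finsetSum]
  · refine Finset.sum_congr rfl fun j _ => ?_
    rw [Set.indicator_of_mem (Set.mem_ofPred.2 (by lia : k + 1 ≤ k + 1 + j)), bernsteinPolynomial]
    simp [add_right_comm]
  · intro j hj
    rw [Set.indicator_of_notMem (by simpa using hj), smul_zero]

section Density

variable {f F : ℝ → ℝ}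

lemma continuous_of_eq_setIntegral_Iic (hf : Integrable f)
    (hF : ∀ x, F x = ∫ u in Set.Iic x, f u) : Continuous F := by
  have : F = fun x => F 0 + ∫ u in (0 : ℝ)..x, f u := by
    ext x
    rw [← intervalIntegral.integral_Iic_sub_Iic hf.integrableOn hf.integrableOn, hF 0, hF x]
    ring
  rw [this]
  exact continuous_const.add (intervalIntegral.continuous_primitive
    (fun a b => hf.intervalIntegrable) 0)

lemma hasDerivAt_of_eq_setIntegral_Iic (hf : Integrable f)
    (hF : ∀ x, F x = ∫ u in Set.Iic x, f u) {q : ℝ} (hq : ContinuousAt f q) :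
    HasDerivAt F (f q) q := by
  have : F = fun x => F 0 + ∫ u in (0 : ℝ)..x, f u := by
    ext x
    rw [← intervalIntegral.integral_Iic_sub_Iic hf.integrableOn hf.integrableOn, hF 0, hF x]
    ring
  rw [this]
  exact (intervalIntegral.integral_hasDerivAt_right hf.intervalIntegrable
    hf.aestronglyMeasurable.stronglyMeasurableAtFilter hq).const_add _

lemma withDensity_Iic (hf0 : ∀ x, 0 ≤ f x) (hf : Integrable f)
    (hF : ∀ x, F x = ∫ u in Set.Iic x, f u) (x : ℝ) :
    volume.withDensity (fun u => ENNReal.ofReal (f u)) (Set.Iic x) = ENNReal.ofReal (F x) := by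
  rw [withDensity_apply _ measurableSet_Iic, hF,
    ofReal_integral_eq_lintegral_ofReal hf.integrableOn (ae_of_all _ hf0)]

lemma isProbabilityMeasure_withDensity_ofReal (hf0 : ∀ x, 0 ≤ f x) (hf1 : ∫ x, f x = 1) :
    IsProbabilityMeasure (volume.withDensity fun u => ENNReal.ofReal (f u)) := by
  have hf : Integrable f := .of_integral_ne_zero (by simp [hf1])
  refine ⟨?_⟩
  rw [withDensity_apply _ MeasurableSet.univ, Measure.restrict_univ,
    ← ofReal_integral_eq_lintegral_ofReal hf (ae_of_all _ hf0), hf1, ENNReal.ofReal_one]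

lemma eq_cdf_withDensity (hf0 : ∀ x, 0 ≤ f x) (hf1 : ∫ x, f x = 1)
    (hF : ∀ x, F x = ∫ u in Set.Iic x, f u) :
    F = cdf (volume.withDensity fun u => ENNReal.ofReal (f u)) := by
  have := isProbabilityMeasure_withDensity_ofReal hf0 hf1
  have hf : Integrable f := .of_integral_ne_zero (by simp [hf1])
  ext x
  have h0 : 0 ≤ F x := by rw [hF]; exact integral_nonneg hf0
  rw [cdf_eq_real, measureReal_def, withDensity_Iic hf0 hf hF, ENNReal.toReal_ofReal h0]

/-- Probability integral transform: the part of the law with density `f` lying in `(-∞, y]` is sent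
by its distribution function to the Lebesgue measure on `(0, F y]`. -/
lemma map_restrict_Iic_withDensity (hf0 : ∀ x, 0 ≤ f x) (hf1 : ∫ x, f x = 1)
    (hF : ∀ x, F x = ∫ u in Set.Iic x, f u) (y : ℝ) :
    ((volume.withDensity fun u => ENNReal.ofReal (f u)).restrict (Set.Iic y)).map F =
      volume.restrict (Set.Ioc 0 (F y)) := by
  have := isProbabilityMeasure_withDensity_ofReal hf0 hf1
  have hf : Integrable f := .of_integral_ne_zero (by simp [hf1])
  have hcont := continuous_of_eq_setIntegral_Iic hf hF
  have hcdf := eq_cdf_withDensity hf0 hf1 hF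
  have hIic := withDensity_Iic hf0 hf hF
  set ν := volume.withDensity fun u => ENNReal.ofReal (f u)
  have hmono : Monotone F := hcdf ▸ monotone_cdf ν
  have hbot : Tendsto F atBot (𝓝 0) := hcdf ▸ tendsto_cdf_atBot ν
  have hnonneg : ∀ x, 0 ≤ F x := fun x => hcdf ▸ cdf_nonneg ν x
  have hivt : ∀ a, 0 < a → a < F y → ∃ s ≤ y, F s = a := by
    intro a ha hay
    obtain ⟨z, hz⟩ := (hbot.eventually (gt_mem_nhds ha)).exists
    have hzy : z ≤ y := (hmono.reflect_lt (hz.trans hay)).le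
    obtain ⟨s, hs, rfl⟩ := intermediate_value_Icc hzy hcont.continuousOn ⟨hz.le, hay.le⟩
    exact ⟨s, hs.2, rfl⟩
  refine Measure.ext_of_Iic _ _ fun a => ?_
  rw [Measure.map_apply hcont.measurable measurableSet_Iic,
    Measure.restrict_apply (hcont.measurable measurableSet_Iic),
    Measure.restrict_apply measurableSet_Iic, Set.inter_comm (Set.Iic a), Set.Ioc_inter_Iic,
    Real.volume_Ioc, sub_zero]
  rcases le_or_gt (F y) a with hya | hya
  · have : F ⁻¹' Set.Iic a ∩ Set.Iic y = Set.Iic y :=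
      Set.inter_eq_right.2 fun u hu => (hmono hu).trans hya
    rw [this, min_eq_left hya, hIic]
  rw [min_eq_right hya.le]
  refine le_antisymm ?_ ?_
  · refine ge_of_tendsto (x := 𝓝[>] a) (f := ENNReal.ofReal)
      (ENNReal.continuous_ofReal.continuousWithinAt) ?_
    filter_upwards [Ioo_mem_nhdsGT hya] with b hb
    rcases le_or_gt b 0 with hb0 | hb0
    · have : F ⁻¹' Set.Iic a = ∅ := by
        ext u
        simpa using (hb.1.trans_le hb0).trans_le (hnonneg u)
      simp [this]
    · obtain ⟨s, -, hs⟩ := hivt b hb0 hb.2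
      rw [← hs, ← hIic]
      refine measure_mono fun u hu => (hmono.reflect_lt ?_).le
      exact hs ▸ (show F u ≤ a from hu.1).trans_lt hb.1
  · rcases le_or_gt a 0 with ha0 | ha0
    · simp [ENNReal.ofReal_of_nonpos ha0]
    · obtain ⟨s, hsy, hs⟩ := hivt a ha0 hya
      rw [← hs, ← hIic]
      exact measure_mono fun u hu => ⟨hmono hu, hu.trans hsy⟩

/-- The substitution `x = F u` on a half line. -/
lemma integral_Iic_comp_mul_density (hf0 : ∀ x, 0 ≤ f x) (hf1 : ∫ x, f x = 1)
    (hF : ∀ x, F x = ∫ u in Set.Iic x, f u) {g : ℝ → ℝ} (hg : Measurable g) (y : ℝ) :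
    ∫ u in Set.Iic y, g (F u) * f u = ∫ x in (0 : ℝ)..F y, g x := by
  have hf : Integrable f := .of_integral_ne_zero (by simp [hf1])
  have hcont := continuous_of_eq_setIntegral_Iic hf hF
  have h0 : 0 ≤ F y := by rw [hF]; exact integral_nonneg hf0
  rw [intervalIntegral.integral_of_le h0, ← map_restrict_Iic_withDensity hf0 hf1 hF,
    integral_map hcont.measurable.aemeasurable hg.aestronglyMeasurable,
    restrict_withDensity measurableSet_Iic, integral_withDensity_eq_integral_toReal_smul₀
      hf.aestronglyMeasurable.aemeasurable.ennreal_ofReal.restrict (by simp)]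
  refine integral_congr_ae (ae_of_all _ fun u => ?_)
  simp [ENNReal.toReal_ofReal (hf0 u), mul_comm]

end Density

/-- The law of the number of orders priced below a level `y` with `F y = p`, given the numbers
`(m, n)` of asks and bids. -/
noncomputable def ordersBelowKernel (p : I) : Kernel (ℕ × ℕ) ℕ :=
  Kernel.ofFunOfCountable fun z => binomial (z.2 + z.1) p

instance (p : I) : IsMarkovKernel (ordersBelowKernel p) :=
  ⟨fun z => inferInstanceAs (IsProbabilityMeasure (binomial (z.2 + z.1) p))⟩

/-- The joint law of `((m, n), j)`: independent Poisson numbers `m` of asks and `n` of bids,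
and the number `j` of orders priced below a level `y` with `F y = p`. -/
noncomputable def orderBookLaw (a b : ℝ≥0) (p : I) : Measure ((ℕ × ℕ) × ℕ) :=
  ((poissonMeasure a).prod (poissonMeasure b)) ⊗ₘ ordersBelowKernel p

instance (a b : ℝ≥0) (p : I) : IsProbabilityMeasure (orderBookLaw a b p) := by
  unfold orderBookLaw; infer_instance

lemma charFun_map_orderBookLaw (a b : ℝ≥0) (p : I) (c k s : ℝ) :
    charFun ((orderBookLaw a b p).map fun w => c * ((w.2 : ℝ) - w.1.2 - k)) s =
      Complex.exp (-(s * c * k * Complex.I)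
        + a * (p : ℝ) * (Complex.exp (s * c * Complex.I) - 1)
        + b * (1 - (p : ℝ)) * (Complex.exp (-(s * c * Complex.I)) - 1)) := by
  set θ : ℂ := s * c * Complex.I with hθ
  have hker : ∀ m n : ℕ, ∫ j, Complex.exp (s * (c * ((j : ℝ) - n - k) : ℝ) * Complex.I)
        ∂(ordersBelowKernel p (m, n)) =
      Complex.exp (-(θ * k)) * ((1 - (p : ℝ) + (p : ℝ) * Complex.exp θ) ^ m *
        (Complex.exp (-θ) * (1 - (p : ℝ) + (p : ℝ) * Complex.exp θ)) ^ n) := by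
    intro m n
    change ∫ j, _ ∂(binomial (n + m) p) = _
    calc _ = ∫ j, Complex.exp (-(θ * k)) * Complex.exp (-θ) ^ n * Complex.exp θ ^ j
          ∂(binomial (n + m) p) := by
          refine integral_congr_ae (ae_of_all _ fun j => ?_)
          simp only [← Complex.exp_nat_mul, ← Complex.exp_add, hθ]
          congr 1
          push_cast
          ring
      _ = _ := by
          rw [integral_const_mul, integral_pow_binomial, mul_pow, pow_add]
          ring
  rw [charFun_apply_real, integral_map (by fun_prop) (by fun_prop), orderBookLaw,
    Measure.integral_compProd]
  · simp_rw [hker]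
    rw [integral_const_mul, integral_prod_mul (fun m : ℕ => _ ^ m) (fun n : ℕ => _ ^ n),
      integral_pow_poissonMeasure, integral_pow_poissonMeasure, ← Complex.exp_add,
      ← Complex.exp_add]
    congr 1
    have : Complex.exp (-θ) * Complex.exp θ = 1 := by rw [← Complex.exp_add]; simp
    linear_combination (b : ℂ) * (p : ℝ) * this
  · refine Integrable.of_bound (C := 1) (by fun_prop) (ae_of_all _ fun w => ?_)
    rw [← Complex.ofReal_mul, Complex.norm_exp_ofReal_mul_I]

lemma tendsto_sqrt_mul_sin_div_sqrt (s : ℝ) :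
    Tendsto (fun t : ℝ => √t * Real.sin (s / √t)) atTop (𝓝 s) := by
  have h := (Real.hasDerivAt_sin 0).hasFDerivAt.lim s (c := fun t : ℝ => √t) (l := atTop)
    (tendsto_norm_atTop_atTop.comp Real.tendsto_sqrt_atTop)
  simpa [div_eq_inv_mul] using h

lemma tendsto_mul_cos_div_sqrt_sub_one (s : ℝ) :
    Tendsto (fun t : ℝ => t * (Real.cos (s / √t) - 1)) atTop (𝓝 (-(s ^ 2 / 2))) := by
  have h := ((tendsto_sqrt_mul_sin_div_sqrt (s / 2)).pow 2).const_mul (-2)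
  rw [show -2 * (s / 2) ^ 2 = -(s ^ 2 / 2) by ring] at h
  refine h.congr' ?_
  filter_upwards [eventually_ge_atTop 0] with t ht
  rw [mul_pow, Real.sq_sqrt ht, show s / √t = 2 * (s / 2 / √t) by ring, Real.cos_two_mul,
    Real.sin_sq]
  ring

/-- Asymptotic normality of the excess of orders priced below the level over the number of bids. -/
lemma tendsto_orderBookLaw {α : ℝ} (hα : α ∈ Set.Ioo (0 : ℝ) 1) {p : ℝ → I} {δ : ℝ}
    (hp : Tendsto (fun t => √t * ((p t : ℝ) - (1 - α))) atTop (𝓝 δ)) (k : ℕ) :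
    Tendsto (fun t : ℝ => (orderBookLaw (α * t).toNNReal ((1 - α) * t).toNNReal (p t)).real
        {w | w.1.2 + k ≤ w.2}) atTop
      (𝓝 ((gaussianReal δ (2 * (α * (1 - α))).toNNReal).real (Set.Ici 0))) := by
  obtain ⟨hα0, hα1⟩ := hα
  have hv : 0 < 2 * (α * (1 - α)) := by have := sub_pos.2 hα1; positivity
  set ν : ℝ → Measure ℝ := fun t =>
    (orderBookLaw (α * t).toNNReal ((1 - α) * t).toNNReal (p t)).map
      fun w => (√t)⁻¹ * ((w.2 : ℝ) - w.1.2 - k) with hν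
  have hνprob : ∀ t, IsProbabilityMeasure (ν t) := fun t =>
    Measure.isProbabilityMeasure_map (by fun_prop)
  have hp' : Tendsto (fun t => (p t : ℝ)) atTop (𝓝 (1 - α)) := by
    have h := (hp.mul (tendsto_inv_atTop_zero.comp Real.tendsto_sqrt_atTop)).add_const (1 - α)
    rw [mul_zero, zero_add] at h
    refine h.congr' ?_
    filter_upwards [eventually_gt_atTop 0] with t ht
    have := Real.sqrt_pos.2 ht
    simp only [Function.comp]
    field_simp
    ring
  have hchar : ∀ s, Tendsto (fun t => charFun (ν t) s) atTop
      (𝓝 (charFun (gaussianReal δ (2 * (α * (1 - α))).toNNReal) s)) := by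
    intro s
    have hre : Tendsto (fun t : ℝ => (α * p t + (1 - α) * (1 - p t)) *
        (t * (Real.cos (s / √t) - 1))) atTop
        (𝓝 ((α * (1 - α) + (1 - α) * (1 - (1 - α))) * -(s ^ 2 / 2))) :=
      ((hp'.const_mul α).add ((hp'.const_sub 1).const_mul (1 - α))).mul
        (tendsto_mul_cos_div_sqrt_sub_one s)
    have him : Tendsto (fun t : ℝ => (√t * ((p t : ℝ) - (1 - α))) * (√t * Real.sin (s / √t))
        - s * k * (√t)⁻¹) atTop (𝓝 (δ * s - s * k * 0)) :=
      (hp.mul (tendsto_sqrt_mul_sin_div_sqrt s)).sub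
        ((tendsto_inv_atTop_zero.comp Real.tendsto_sqrt_atTop).const_mul _)
    have h := (Complex.continuous_exp.tendsto _).comp
      (((Complex.continuous_ofReal.tendsto _).comp hre).add
      (((Complex.continuous_ofReal.tendsto _).comp him).mul_const Complex.I))
    rw [charFun_gaussianReal]
    convert h.congr' ?_ using 2
    · congr 1
      rw [Real.coe_toNNReal _ hv.le]
      push_cast
      ring
    · filter_upwards [eventually_gt_atTop 0] with t ht
      have hsq : ((√t : ℝ) : ℂ) * (√t : ℝ) = t := by
        rw [← Complex.ofReal_mul, Real.mul_self_sqrt ht.le]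
      simp only [Function.comp, hν]
      rw [charFun_map_orderBookLaw]
      congr 1
      have e1 : (s : ℂ) * ((√t)⁻¹ : ℝ) = ((s / √t : ℝ) : ℂ) := by
        push_cast; ring
      have e2 : Complex.exp (-((s / √t : ℝ) * Complex.I)) =
          Complex.cos (s / √t : ℝ) - Complex.sin (s / √t : ℝ) * Complex.I := by
        rw [← neg_mul, Complex.exp_mul_I, Complex.cos_neg, Complex.sin_neg]; ring
      rw [e1, e2, Complex.exp_mul_I,
        Real.coe_toNNReal _ (by positivity),
        Real.coe_toNNReal _ (mul_nonneg (sub_pos.2 hα1).le ht.le)]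
      push_cast
      linear_combination (((p t : ℝ) : ℂ) - (1 - α)) * Complex.sin (s / (√t : ℝ)) * Complex.I * hsq
  have hlim : Tendsto (fun t => (ν t).real (Set.Ici 0)) atTop
      (𝓝 ((gaussianReal δ (2 * (α * (1 - α))).toNNReal).real (Set.Ici 0))) := by
    refine tendsto_of_seq_tendsto fun u hu => ?_
    let νs : ℕ → ProbabilityMeasure ℝ := fun i => ⟨ν (u i), hνprob _⟩
    let γ : ProbabilityMeasure ℝ :=
      ⟨gaussianReal δ (2 * (α * (1 - α))).toNNReal, inferInstance⟩
    have hw : Tendsto νs atTop (𝓝 γ) :=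
      ProbabilityMeasure.tendsto_of_tendsto_charFun fun s => (hchar s).comp hu
    have := nullSingletonClass_gaussianReal (μ := δ) (v := (2 * (α * (1 - α))).toNNReal)
      (Real.toNNReal_pos.2 hv).ne'
    have h := ProbabilityMeasure.tendsto_measure_of_null_frontier_of_tendsto' hw
      (E := Set.Ici 0) (by simp [γ, measure_singleton])
    exact (ENNReal.tendsto_toReal (measure_ne_top _ _)).comp h
  refine hlim.congr' ?_
  filter_upwards [eventually_gt_atTop 0] with t ht
  have := Real.sqrt_pos.2 ht
  rw [hν, map_measureReal_apply (by fun_prop) measurableSet_Ici]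
  congr 1
  ext w
  simp only [Set.mem_preimage, Set.mem_Ici, Set.mem_ofPred_eq]
  rw [mul_nonneg_iff_of_pos_left (by positivity), sub_sub, sub_nonneg]
  norm_cast

lemma poissonMeasure_real_Ici_one (r : ℝ≥0) :
    (poissonMeasure r).real {n | 1 ≤ n} = 1 - Real.exp (-r) := by
  have : {n : ℕ | 1 ≤ n} = {0}ᶜ := by ext n; simp [Nat.one_le_iff_ne_zero]
  rw [this, probReal_compl_eq_one_sub (by measurability), poissonMeasure_real_singleton]
  simp

lemma gaussianReal_real_Ici_zero {v : ℝ≥0} (hv : v ≠ 0) (x : ℝ) :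
    (gaussianReal (√v * x) v).real (Set.Ici 0) = (gaussianReal 0 1).real (Set.Iic x) := by
  have hpos : 0 < √(v : ℝ) := Real.sqrt_pos.2 (by positivity)
  have hmap : (gaussianReal 0 1).map (fun z => -√v * z + √v * x) = gaussianReal (√v * x) v := by
    have h := Measure.map_map (μ := gaussianReal 0 1) (g := fun z : ℝ => z + √v * x)
      (f := fun z : ℝ => -√v * z) (by fun_prop) (by fun_prop)
    simp only [Function.comp_def] at h
    rw [← h, gaussianReal_map_const_mul, gaussianReal_map_add_const]
    congr 1
    · simp
    · ext; simp
  rw [← hmap, map_measureReal_apply (by fun_prop) measurableSet_Ici]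
  congr 1
  ext z
  simp only [Set.mem_preimage, Set.mem_Ici, Set.mem_Iic]
  rw [show -√(v : ℝ) * z + √v * x = √v * (x - z) by ring, mul_nonneg_iff_of_pos_left hpos,
    sub_nonneg]

/-- If, given `m ≥ 1` asks and `n ≥ 1` bids, the event `S t` has the probability that at least
`n + k` of the `n + m` orders are priced below the level of probability `p t`, then its conditional
probability is asymptotically that of the normal limit. -/
lemma tendsto_conditional_of_binomial_tail {Ω : Type*} [MeasurableSpace Ω] (μ : Measure Ω)
    [IsProbabilityMeasure μ] {α : ℝ} (hα : α ∈ Set.Ioo (0 : ℝ) 1) (M N : ℝ → Ω → ℕ)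
    (hM : ∀ t : ℝ, 0 < t → ∀ m : ℕ,
      μ {ω | M t ω = m}
        = ENNReal.ofReal (Real.exp (-(α * t)) * (α * t) ^ m / (m.factorial : ℝ)))
    (hN : ∀ t : ℝ, 0 < t → ∀ n : ℕ,
      μ {ω | N t ω = n}
        = ENNReal.ofReal (Real.exp (-((1 - α) * t)) * ((1 - α) * t) ^ n / (n.factorial : ℝ)))
    (hindep : ∀ t : ℝ, 0 < t → ∀ m n : ℕ,
      μ {ω | M t ω = m ∧ N t ω = n} = μ {ω | M t ω = m} * μ {ω | N t ω = n})
    {p : ℝ → I} {δ : ℝ} (hp : Tendsto (fun t => √t * ((p t : ℝ) - (1 - α))) atTop (𝓝 δ))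
    (k : ℕ) (S : ℝ → Set Ω)
    (hS : ∀ t : ℝ, 0 < t → ∀ m n : ℕ, 1 ≤ m → 1 ≤ n →
      μ (S t ∩ {ω | M t ω = m ∧ N t ω = n}) = μ {ω | M t ω = m ∧ N t ω = n} *
        ENNReal.ofReal ((binomial (n + m) (p t)).real {j | n + k ≤ j})) :
    Tendsto (fun t => (μ (S t ∩ {ω | 1 ≤ M t ω ∧ 1 ≤ N t ω})).toReal /
        (μ {ω | 1 ≤ M t ω ∧ 1 ≤ N t ω}).toReal) atTop
      (𝓝 ((gaussianReal δ (2 * (α * (1 - α))).toNNReal).real (Set.Ici 0))) := by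
  set a : ℝ → ℝ≥0 := fun t => (α * t).toNNReal with ha
  set b : ℝ → ℝ≥0 := fun t => ((1 - α) * t).toNNReal with hb
  set G : Set (ℕ × ℕ) := {z | 1 ≤ z.1 ∧ 1 ≤ z.2} with hG
  set E : Set ((ℕ × ℕ) × ℕ) := {w | w.1.2 + k ≤ w.2} with hE
  set π : ℝ → Measure (ℕ × ℕ) := fun t => (poissonMeasure (a t)).prod (poissonMeasure (b t)) with hπ
  have hfib : ∀ t : ℝ, 0 < t → ∀ z : ℕ × ℕ,
      μ ((fun ω => (M t ω, N t ω)) ⁻¹' {z}) = π t {z} := by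
    intro t ht z
    have hset : (fun ω => (M t ω, N t ω)) ⁻¹' {z} = {ω | M t ω = z.1 ∧ N t ω = z.2} := by
      ext ω; simp [Prod.ext_iff]
    rw [hset, hindep t ht, hM t ht, hN t ht, hπ]
    dsimp only
    rw [← Set.singleton_prod_singleton (a := z.1) (b := z.2), Measure.prod_prod,
      poissonMeasure_singleton, poissonMeasure_singleton, ha, hb,
      Real.coe_toNNReal _ (mul_pos hα.1 ht).le,
      Real.coe_toNNReal _ (mul_pos (sub_pos.2 hα.2) ht).le]
  have hone : ∀ t : ℝ, 0 < t → ∑' z : ℕ × ℕ, μ ((fun ω => (M t ω, N t ω)) ⁻¹' {z}) = 1 := by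
    intro t ht
    have h := lintegral_countable' (μ := π t) fun _ => 1
    simp only [lintegral_one, measure_univ, one_mul] at h
    rw [h, tsum_congr (hfib t ht)]
  have hdecomp : ∀ t : ℝ, 0 < t → ∀ (T : Set Ω) (φ : ℕ × ℕ → ℝ≥0∞),
      (∀ m n, 1 ≤ m → 1 ≤ n → μ (T ∩ {ω | M t ω = m ∧ N t ω = n}) =
        μ {ω | M t ω = m ∧ N t ω = n} * φ (m, n)) →
      μ (T ∩ {ω | 1 ≤ M t ω ∧ 1 ≤ N t ω}) = ∫⁻ z in G, φ z ∂(π t) := by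
    intro t ht T φ hT
    rw [measure_eq_tsum_inter_fiber μ _ (hone t ht), ← lintegral_indicator .of_discrete,
      lintegral_countable']
    refine tsum_congr fun z => ?_
    have hset : (fun ω => (M t ω, N t ω)) ⁻¹' {z} = {ω | M t ω = z.1 ∧ N t ω = z.2} := by
      ext ω; simp [Prod.ext_iff]
    by_cases hz : z ∈ G
    · have : T ∩ {ω | 1 ≤ M t ω ∧ 1 ≤ N t ω} ∩ (fun ω => (M t ω, N t ω)) ⁻¹' {z} =
          T ∩ {ω | M t ω = z.1 ∧ N t ω = z.2} := by
        rw [hset]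
        ext ω
        simp only [Set.mem_inter_iff, Set.mem_ofPred_eq]
        refine ⟨fun h => ⟨h.1.1, h.2⟩, fun h => ⟨⟨h.1, ?_⟩, h.2⟩⟩
        rw [h.2.1, h.2.2]
        exact hz
      rw [this, hT _ _ hz.1 hz.2, ← hset, hfib t ht, Set.indicator_of_mem hz, mul_comm]
    · have : T ∩ {ω | 1 ≤ M t ω ∧ 1 ≤ N t ω} ∩ (fun ω => (M t ω, N t ω)) ⁻¹' {z} = ∅ := by
        rw [Set.eq_empty_iff_forall_notMem]
        rintro ω ⟨⟨-, h⟩, rfl⟩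
        exact hz h
      rw [this, measure_empty, Set.indicator_of_notMem hz, zero_mul]
  have hden : ∀ t : ℝ, 0 < t → (μ {ω | 1 ≤ M t ω ∧ 1 ≤ N t ω}).toReal =
      (1 - Real.exp (-(α * t))) * (1 - Real.exp (-((1 - α) * t))) := by
    intro t ht
    have h := hdecomp t ht Set.univ (fun _ => 1) (by simp)
    have hGprod : G = {m | 1 ≤ m} ×ˢ {n | 1 ≤ n} := rfl
    rw [Set.univ_inter, setLIntegral_one] at h
    rw [h, hGprod, hπ]
    dsimp only
    rw [Measure.prod_prod, ENNReal.toReal_mul, ← measureReal_def, ← measureReal_def,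
      poissonMeasure_real_Ici_one, poissonMeasure_real_Ici_one, ha, hb,
      Real.coe_toNNReal _ (mul_pos hα.1 ht).le,
      Real.coe_toNNReal _ (mul_pos (sub_pos.2 hα.2) ht).le]
  have hnum : ∀ t : ℝ, 0 < t → (μ (S t ∩ {ω | 1 ≤ M t ω ∧ 1 ≤ N t ω})).toReal =
      (orderBookLaw (a t) (b t) (p t)).real (E ∩ Prod.fst ⁻¹' G) := by
    intro t ht
    have h := hdecomp t ht (S t)
      (fun z => ENNReal.ofReal ((binomial (z.2 + z.1) (p t)).real {j | z.2 + k ≤ j})) (hS t ht)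
    rw [h, measureReal_def, orderBookLaw, Measure.compProd_apply .of_discrete,
      ← lintegral_indicator .of_discrete]
    congr 1
    refine lintegral_congr fun z => ?_
    by_cases hz : z ∈ G
    · rw [Set.indicator_of_mem hz, measureReal_def, ENNReal.ofReal_toReal (measure_ne_top _ _)]
      have : Prod.mk z ⁻¹' (E ∩ Prod.fst ⁻¹' G) = {j | z.2 + k ≤ j} := by
        ext j; simp [hE, hz]
      rw [this]
      rfl
    · have : Prod.mk z ⁻¹' (E ∩ Prod.fst ⁻¹' G) = ∅ := by
        ext j; simp [hz]
      rw [Set.indicator_of_notMem hz, this, measure_empty]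
  have hG_law : ∀ t : ℝ, 0 < t → (orderBookLaw (a t) (b t) (p t)).real (Prod.fst ⁻¹' G) =
      (μ {ω | 1 ≤ M t ω ∧ 1 ≤ N t ω}).toReal := by
    intro t ht
    have h := hdecomp t ht Set.univ (fun _ => 1) (by simp)
    rw [Set.univ_inter, setLIntegral_one] at h
    rw [h, measureReal_def, orderBookLaw, ← Measure.fst_apply .of_discrete,
      Measure.fst_compProd]
  have hexp : ∀ c : ℝ, 0 < c → Tendsto (fun t : ℝ => 1 - Real.exp (-(c * t))) atTop (𝓝 1) := by
    intro c hc
    simpa using (Real.tendsto_exp_neg_atTop_nhds_zero.comp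
      (tendsto_id.const_mul_atTop hc)).const_sub 1
  have hdenlim : Tendsto (fun t => (μ {ω | 1 ≤ M t ω ∧ 1 ≤ N t ω}).toReal) atTop (𝓝 1) := by
    have h := (hexp α hα.1).mul (hexp (1 - α) (sub_pos.2 hα.2))
    rw [mul_one] at h
    refine h.congr' ?_
    filter_upwards [eventually_gt_atTop 0] with t ht using (hden t ht).symm
  have hlaw := tendsto_orderBookLaw hα hp k
  have hnumlim : Tendsto (fun t => (μ (S t ∩ {ω | 1 ≤ M t ω ∧ 1 ≤ N t ω})).toReal) atTop
      (𝓝 ((gaussianReal δ (2 * (α * (1 - α))).toNNReal).real (Set.Ici 0))) := by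
    have hlow := hlaw.sub (hdenlim.const_sub 1)
    rw [sub_self, sub_zero] at hlow
    refine tendsto_of_tendsto_of_tendsto_of_le_of_le' hlow hlaw ?_ ?_
    · filter_upwards [eventually_gt_atTop 0] with t ht
      rw [hnum t ht, ← hG_law t ht, ← probReal_compl_eq_one_sub .of_discrete,
        sub_le_iff_le_add]
      refine (measureReal_mono ?_).trans (measureReal_union_le _ _)
      intro w hw
      by_cases h : w ∈ Prod.fst ⁻¹' G
      · exact Or.inl ⟨hw, h⟩
      · exact Or.inr h
    · filter_upwards [eventually_gt_atTop 0] with t ht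
      rw [hnum t ht]
      exact measureReal_mono Set.inter_subset_left
  simpa [Pi.div_def] using hnumlim.div hdenlim one_ne_zero

/-- Fix `α ∈ (0,1)` and an absolutely continuous distribution `F` with
density `f`, `f` continuous and strictly positive at the quantile `q = F⁻¹(1−α)`.  For each
`t > 0`, let `M_t`, `N_t` be independent Poisson random variables with parameters `αt` and
`(1−α)t`, and conditionally on `M_t = m ≥ 1`, `N_t = n ≥ 1`, let `L_t` (resp. `U_t`) be
distributed as the `n`-th (resp. `(n+1)`-th) order statistic of an i.i.d. `(n+m)`-sample from
`F`.  Then, as `t → ∞`, the conditional law of `√t f(q) (L_t − q)/√(2α(1−α))` given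
`{M_t ≥ 1, N_t ≥ 1}` converges weakly to the standard normal law, and likewise for `U_t`
(expressed via pointwise convergence of conditional distribution functions). -/
theorem stmt_10 {Ω : Type*} [MeasurableSpace Ω] (μ : Measure Ω) [IsProbabilityMeasure μ]
    (α : ℝ) (hα : α ∈ Set.Ioo (0 : ℝ) 1)
    (f : ℝ → ℝ) (hf0 : ∀ x, 0 ≤ f x) (hf1 : ∫ x, f x = 1)
    (F : ℝ → ℝ) (hF : ∀ x, F x = ∫ u in Set.Iic x, f u)
    (q : ℝ) (hq : F q = 1 - α) (hfq : 0 < f q) (hfcont : ContinuousAt f q)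
    (M N : ℝ → Ω → ℕ) (L U : ℝ → Ω → ℝ)
    (hM : ∀ t : ℝ, 0 < t → ∀ m : ℕ,
      μ {ω | M t ω = m}
        = ENNReal.ofReal (Real.exp (-(α * t)) * (α * t) ^ m / (m.factorial : ℝ)))
    (hN : ∀ t : ℝ, 0 < t → ∀ n : ℕ,
      μ {ω | N t ω = n}
        = ENNReal.ofReal (Real.exp (-((1 - α) * t)) * ((1 - α) * t) ^ n / (n.factorial : ℝ)))
    (hindep : ∀ t : ℝ, 0 < t → ∀ m n : ℕ,
      μ {ω | M t ω = m ∧ N t ω = n} = μ {ω | M t ω = m} * μ {ω | N t ω = n})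
    (hL : ∀ t : ℝ, 0 < t → ∀ m n : ℕ, 1 ≤ m → 1 ≤ n → ∀ x : ℝ,
      μ {ω | L t ω ≤ x ∧ M t ω = m ∧ N t ω = n}
        = μ {ω | M t ω = m ∧ N t ω = n} *
            ENNReal.ofReal (∫ u in Set.Iic x,
              (((n + m).factorial : ℝ) / (((n - 1).factorial : ℝ) * (m.factorial : ℝ))) *
                F u ^ (n - 1) * (1 - F u) ^ m * f u))
    (hU : ∀ t : ℝ, 0 < t → ∀ m n : ℕ, 1 ≤ m → 1 ≤ n → ∀ x : ℝ,
      μ {ω | U t ω ≤ x ∧ M t ω = m ∧ N t ω = n}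
        = μ {ω | M t ω = m ∧ N t ω = n} *
            ENNReal.ofReal (∫ u in Set.Iic x,
              (((n + m).factorial : ℝ) / ((n.factorial : ℝ) * ((m - 1).factorial : ℝ))) *
                F u ^ n * (1 - F u) ^ (m - 1) * f u)) :
    ∀ x : ℝ,
      Tendsto (fun t : ℝ =>
          (μ {ω | Real.sqrt t * f q * (L t ω - q) / Real.sqrt (2 * (α * (1 - α))) ≤ x ∧
              1 ≤ M t ω ∧ 1 ≤ N t ω}).toReal /
            (μ {ω | 1 ≤ M t ω ∧ 1 ≤ N t ω}).toReal)
        atTop (𝓝 ((gaussianReal 0 1 (Set.Iic x)).toReal)) ∧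
      Tendsto (fun t : ℝ =>
          (μ {ω | Real.sqrt t * f q * (U t ω - q) / Real.sqrt (2 * (α * (1 - α))) ≤ x ∧
              1 ≤ M t ω ∧ 1 ≤ N t ω}).toReal /
            (μ {ω | 1 ≤ M t ω ∧ 1 ≤ N t ω}).toReal)
        atTop (𝓝 ((gaussianReal 0 1 (Set.Iic x)).toReal)) := by
  have hf : Integrable f := .of_integral_ne_zero (by simp [hf1])
  have hprob := isProbabilityMeasure_withDensity_ofReal hf0 hf1
  have hcdf := eq_cdf_withDensity hf0 hf1 hF
  have hmem : ∀ y, F y ∈ I := fun y => by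
    rw [hcdf]; exact ⟨cdf_nonneg _ _, cdf_le_one _ _⟩
  have hα' : 0 < 1 - α := sub_pos.2 hα.2
  have hv : 0 < 2 * (α * (1 - α)) := mul_pos two_pos (mul_pos hα.1 hα')
  set c := √(2 * (α * (1 - α))) with hc
  have hc0 : 0 < c := Real.sqrt_pos.2 hv
  intro x
  set y : ℝ → ℝ := fun t => q + (√t)⁻¹ * (c * x / f q) with hy
  have hp : Tendsto (fun t => √t * (((⟨F (y t), hmem _⟩ : I) : ℝ) - (1 - α))) atTop
      (𝓝 (c * x)) := by
    have h := (hasDerivAt_of_eq_setIntegral_Iic hf hF hfcont).hasFDerivAt.lim (c * x / f q)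
      (c := fun t : ℝ => √t) (l := atTop)
      (tendsto_norm_atTop_atTop.comp Real.tendsto_sqrt_atTop)
    rw [hq] at h
    simpa [hy, hfq.ne'] using h
  have hlevel : ∀ t : ℝ, 0 < t → ∀ l : ℝ, √t * f q * (l - q) / c ≤ x ↔ l ≤ y t := by
    intro t ht l
    have := Real.sqrt_pos.2 ht
    have e : y t = q + c * x / (√t * f q) := by
      simp only [hy]; field_simp
    rw [e, div_le_iff₀ hc0, ← sub_le_iff_le_add', le_div_iff₀ (by positivity)]
    constructor <;> intro h <;> linarith
  have htail : ∀ (t : ℝ) (k r : ℕ), ∫ u in Set.Iic (y t),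
        (((k + r + 1).factorial : ℝ) / ((k.factorial : ℝ) * (r.factorial : ℝ))) *
          F u ^ k * (1 - F u) ^ r * f u =
      (binomial (k + r + 1) ⟨F (y t), hmem _⟩).real {j | k + 1 ≤ j} := by
    intro t k r
    rw [binomial_real_tail]
    exact integral_Iic_comp_mul_density hf0 hf1 hF (g := fun z =>
      (((k + r + 1).factorial : ℝ) / ((k.factorial : ℝ) * (r.factorial : ℝ))) * z ^ k *
        (1 - z) ^ r) (by fun_prop) (y t)
  have hlim : (gaussianReal (c * x) (2 * (α * (1 - α))).toNNReal).real (Set.Ici 0) =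
      (gaussianReal 0 1 (Set.Iic x)).toReal := by
    have h := gaussianReal_real_Ici_zero (Real.toNNReal_pos.2 hv).ne' x
    rwa [Real.coe_toNNReal _ hv.le] at h
  rw [← hlim]
  constructor
  · refine tendsto_conditional_of_binomial_tail μ hα M N hM hN hindep hp 0
      (fun t => {ω | √t * f q * (L t ω - q) / c ≤ x}) fun t ht m n hm hn => ?_
    obtain ⟨k, rfl⟩ := Nat.exists_eq_add_of_le' hn
    have h := hL t ht m (k + 1) hm hn (y t)
    rw [Nat.add_sub_cancel, show k + 1 + m = k + m + 1 by ring, htail] at h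
    simp_rw [hlevel t ht, add_zero, show k + 1 + m = k + m + 1 by ring]
    exact h
  · refine tendsto_conditional_of_binomial_tail μ hα M N hM hN hindep hp 1
      (fun t => {ω | √t * f q * (U t ω - q) / c ≤ x}) fun t ht m n hm hn => ?_
    obtain ⟨r, rfl⟩ := Nat.exists_eq_add_of_le' hm
    have h := hU t ht (r + 1) n hm hn (y t)
    rw [Nat.add_sub_cancel, ← add_assoc, htail] at h
    simp_rw [hlevel t ht, ← add_assoc]
    exact h
end

section
/- Fix α ∈ (0,1) and let F be an absolutely continuous probability distribution on ℝ with density f, with f continuous and strictly positive at q = F^{-1}(1−α). For each integer N ≥ 1, let n_N be binomial with parameters N and 1−α, and conditionally on n_N = n with 1 ≤ n ≤ N, let L_N be distributed as the n-th order statistic of an i.i.d. sample of size N from F. Then, as N → ∞, sqrt(N) (L_N − q) converges in distribution to the centered normal law with standard deviation sqrt(2) · sqrt(α(1−α)) / f(q). -/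
open MeasureTheory ProbabilityTheory Filter Topology

theorem AbsolutelyContinuousOnInterval.polynomial_eval {g : ℝ → ℝ} {a b : ℝ}
    (hg : AbsolutelyContinuousOnInterval g a b) (P : Polynomial ℝ) :
    AbsolutelyContinuousOnInterval (fun x => P.eval (g x)) a b := by
  have hconst (c : ℝ) : AbsolutelyContinuousOnInterval (fun _ : ℝ => c) a b :=
    (LipschitzWith.const c).lipschitzOnWith.absolutelyContinuousOnInterval
  induction P using Polynomial.induction_on' with
  | add P Q hP hQ => simpa only [Polynomial.eval_add] using hP.fun_add hQ
  | monomial n c =>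
    simp only [Polynomial.eval_monomial]
    refine AbsolutelyContinuousOnInterval.const_mul c ?_
    induction n with
    | zero => simpa using hconst 1
    | succ n ih => simpa only [pow_succ] using ih.fun_mul hg

/-- Change of variables `s = ∫_{-∞}^u f` for a polynomial integrand. -/
theorem integral_Iic_derivative_eval_primitive_mul {f F : ℝ → ℝ} (hf : Integrable f)
    (hF : ∀ x, F x = ∫ u in Set.Iic x, f u) (P : Polynomial ℝ) (y : ℝ) :
    ∫ u in Set.Iic y, P.derivative.eval (F u) * f u = P.eval (F y) - P.eval 0 := by
  have hFsub (a u : ℝ) : F u = F a + ∫ v in a..u, f v := by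
    rw [hF, hF, ← intervalIntegral.integral_Iic_sub_Iic hf.integrableOn hf.integrableOn]; ring
  have hFcont : Continuous F := by
    rw [show F = fun u => F 0 + ∫ v in (0 : ℝ)..u, f v from funext (hFsub 0)]
    exact continuous_const.add
      (intervalIntegral.continuous_primitive (fun _ _ => hf.intervalIntegrable) 0)
  have hFbound (u : ℝ) : F u ∈ Set.Icc (-∫ v, ‖f v‖) (∫ v, ‖f v‖) := by
    rw [Set.mem_Icc, ← abs_le, hF]
    exact (norm_integral_le_integral_norm f).trans
      (setIntegral_le_integral hf.norm (ae_of_all _ fun _ => norm_nonneg _))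
  have hFlim : Tendsto F atBot (𝓝 0) := by
    have h := (intervalIntegral_tendsto_integral_Iic y hf.integrableOn tendsto_id).const_sub (F y)
    rw [← hF, sub_self] at h
    refine h.congr fun a => ?_
    rw [hFsub a y]; simp
  have hFderiv : ∀ᵐ u, HasDerivAt F (f u) u := by
    filter_upwards [LocallyIntegrable.ae_hasDerivAt_integral hf.locallyIntegrable] with u hu
    rw [show F = fun u => F 0 + ∫ v in (0 : ℝ)..u, f v from funext (hFsub 0)]
    exact (hu 0).const_add _
  have hint : Integrable fun u => P.derivative.eval (F u) * f u := by
    obtain ⟨C, hC⟩ := isCompact_Icc.exists_bound_of_continuousOn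
      (P.derivative.continuous.continuousOn (s := Set.Icc (-∫ v, ‖f v‖) (∫ v, ‖f v‖)))
    exact hf.bdd_mul (P.derivative.continuous.comp hFcont).aestronglyMeasurable
      (ae_of_all _ fun u => hC _ (hFbound u))
  have hfinite (a : ℝ) :
      ∫ u in a..y, P.derivative.eval (F u) * f u = P.eval (F y) - P.eval (F a) := by
    have hac : AbsolutelyContinuousOnInterval F a y := by
      rw [show F = fun u => F a + ∫ v in a..u, f v from funext (hFsub a)]
      exact AbsolutelyContinuousOnInterval.fun_add
        (LipschitzWith.const (F a)).lipschitzOnWith.absolutelyContinuousOnInterval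
        (hf.intervalIntegrable.absolutelyContinuousOnInterval_intervalIntegral (by simp))
    rw [← (hac.polynomial_eval P).integral_deriv_eq_sub]
    refine intervalIntegral.integral_congr_ae ?_
    filter_upwards [hFderiv] with u hu _
    exact ((P.hasDerivAt (F u)).comp u hu).deriv.symm
  refine tendsto_nhds_unique
    (intervalIntegral_tendsto_integral_Iic y hint.integrableOn tendsto_id) ?_
  simp only [id, hfinite]
  exact ((P.continuous.tendsto 0).comp hFlim).const_sub _

/-- The upper tail of the binomial distribution, as a polynomial in the success probability,
has the beta density as derivative. -/
theorem derivative_sum_Icc_bernsteinPolynomial (N n : ℕ) :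
    Polynomial.derivative (∑ k ∈ Finset.Icc (n + 1) N, bernsteinPolynomial ℝ N k) =
      N * bernsteinPolynomial ℝ (N - 1) n := by
  rcases Nat.lt_or_ge n N with h | h
  · rw [Polynomial.derivative_sum]
    have hshift : Finset.Icc (n + 1) N = Finset.Ico (n + 1) (N + 1) := by
      ext; simp
    rw [hshift, ← Finset.sum_Ico_add' _ n N 1]
    simp only [bernsteinPolynomial.derivative_succ]
    rw [← Finset.mul_sum, ← neg_inj, ← mul_neg, ← Finset.sum_neg_distrib]
    simp only [neg_sub]
    rw [Finset.sum_Ico_sub _ h.le,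
      bernsteinPolynomial.eq_zero_of_lt ℝ (show N - 1 < N by omega)]
    ring
  · rw [Finset.Icc_eq_empty (by omega)]
    rcases Nat.eq_zero_or_pos N with rfl | hN
    · simp
    · simp [bernsteinPolynomial.eq_zero_of_lt ℝ (show N - 1 < n by omega)]

theorem binomial_real_Ici (N n : ℕ) (p : unitInterval) :
    (binomial N p).real (Set.Ici n) =
      (∑ k ∈ Finset.Icc n N, bernsteinPolynomial ℝ N k).eval (p : ℝ) := by
  have h := integral_binomial (n := N) (p := p) ((Set.Ici n).indicator (1 : ℕ → ℝ))
  rw [integral_indicator_one (by measurability)] at h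
  rw [h, Polynomial.eval_finsetSum,
    show Finset.Icc n N = (Finset.Iic N).filter (n ≤ ·) by ext; simp [and_comm],
    Finset.sum_filter]
  refine Finset.sum_congr rfl fun k _ => ?_
  by_cases hk : n ≤ k <;> simp [hk, bernsteinPolynomial]

/-- The distribution function of an order statistic is a binomial upper tail. -/
theorem integral_orderStatistic_density {f F : ℝ → ℝ} (hf : Integrable f)
    (hF : ∀ x, F x = ∫ u in Set.Iic x, f u) {N n : ℕ} (hn : 1 ≤ n) (hnN : n ≤ N) (y : ℝ)
    (p : unitInterval) (hp : (p : ℝ) = F y) :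
    ∫ u in Set.Iic y, ((N.factorial : ℝ) / (((n - 1).factorial : ℝ) * ((N - n).factorial : ℝ))) *
        F u ^ (n - 1) * (1 - F u) ^ (N - n) * f u = (binomial N p).real (Set.Ici n) := by
  obtain ⟨m, rfl⟩ : ∃ m, n = m + 1 := ⟨n - 1, by omega⟩
  obtain ⟨M, rfl⟩ : ∃ M, N = M + 1 := ⟨N - 1, by omega⟩
  have hmM : m ≤ M := by omega
  have h := integral_Iic_derivative_eval_primitive_mul hf hF
    (∑ k ∈ Finset.Icc (m + 1) (M + 1), bernsteinPolynomial ℝ (M + 1) k) y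
  have h0 : (∑ k ∈ Finset.Icc (m + 1) (M + 1), bernsteinPolynomial ℝ (M + 1) k).eval 0 = 0 := by
    rw [Polynomial.eval_finsetSum]
    refine Finset.sum_eq_zero fun k hk => ?_
    have : k ≠ 0 := by have := (Finset.mem_Icc.1 hk).1; omega
    simp [bernsteinPolynomial, this]
  rw [h0, sub_zero, derivative_sum_Icc_bernsteinPolynomial] at h
  rw [binomial_real_Ici, hp, ← h]
  congr 1 with u
  simp only [bernsteinPolynomial, Polynomial.eval_mul, Polynomial.eval_natCast,
    Polynomial.eval_pow, Polynomial.eval_X, Polynomial.eval_sub, Polynomial.eval_one,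
    Nat.add_sub_cancel, Nat.add_sub_add_right, Nat.cast_choose ℝ hmM, Nat.factorial_succ]
  push_cast
  ring

theorem nullMeasurableSet_of_measure_add_measure_compl_le {Ω : Type*} [MeasurableSpace Ω]
    {μ : Measure Ω} [IsFiniteMeasure μ] {s : Set Ω} (h : μ s + μ sᶜ ≤ μ Set.univ) :
    NullMeasurableSet s μ := by
  have hunion : toMeasurable μ s ∪ toMeasurable μ sᶜ = Set.univ :=
    Set.eq_univ_of_univ_subset <| (Set.union_compl_self s).symm.subset.trans <|
      Set.union_subset_union (subset_toMeasurable μ s) (subset_toMeasurable μ sᶜ)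
  have hinter : μ (toMeasurable μ s ∩ toMeasurable μ sᶜ) = 0 := by
    have := measure_union_add_inter (μ := μ) (toMeasurable μ s) (measurableSet_toMeasurable μ sᶜ)
    rw [hunion, measure_toMeasurable, measure_toMeasurable] at this
    exact nonpos_iff_eq_zero.1 <| ENNReal.le_of_add_le_add_left (measure_ne_top μ Set.univ)
      (by rw [this, add_zero]; exact h)
  have hdiff : μ (toMeasurable μ s \ s) = 0 :=
    measure_mono_null (Set.inter_subset_inter_right _ (subset_toMeasurable μ sᶜ)) hinter
  have hae : toMeasurable μ s =ᵐ[μ] s :=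
    (ae_le_set.2 hdiff).antisymm (subset_toMeasurable μ s).eventuallyLE
  exact (measurableSet_toMeasurable μ s).nullMeasurableSet.congr hae

/-- If the outer measures of the fibers of `X` add up to the total mass, then they split
every set additively. -/
theorem measure_eq_tsum_inter_fiber_s11 {Ω : Type*} [MeasurableSpace Ω] {μ : Measure Ω}
    [IsFiniteMeasure μ] {X : Ω → ℕ} (hX : ∑' j, μ {ω | X ω = j} ≤ μ Set.univ) (A : Set Ω) :
    μ A = ∑' j, μ {ω | ω ∈ A ∧ X ω = j} := by
  have hnull (j : ℕ) : NullMeasurableSet {ω | X ω = j} μ := by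
    refine nullMeasurableSet_of_measure_add_measure_compl_le (le_trans ?_ hX)
    rw [ENNReal.tsum_eq_add_tsum_ite j]
    gcongr
    have hsub : {ω | X ω = j}ᶜ ⊆ ⋃ i, if i = j then ∅ else {ω | X ω = i} := by
      intro ω hω
      have hω' : X ω ≠ j := hω
      exact Set.mem_iUnion.2 ⟨X ω, by simp [hω']⟩
    refine (measure_mono hsub).trans ((measure_iUnion_le _).trans (le_of_eq ?_))
    congr 1 with i
    split_ifs <;> simp
  have hnullA (j : ℕ) : NullMeasurableSet {ω | X ω = j} (μ.restrict A) :=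
    (hnull j).mono_ac Measure.restrict_le_self.absolutelyContinuous
  have hunion : (⋃ j, {ω | X ω = j}) = Set.univ := Set.eq_univ_of_forall fun ω => by simp
  rw [← Measure.restrict_apply_univ A, ← hunion, measure_iUnion₀ ?_ hnullA]
  · congr 1 with j
    rw [Measure.restrict_apply₀ (hnullA j)]
    congr 1 with ω
    exact and_comm
  · intro i j hij
    refine Disjoint.aedisjoint (Set.disjoint_left.2 fun ω h1 h2 => hij ?_)
    exact Eq.trans (Eq.symm h1) h2

theorem integral_exp_mul_I_binomial (N : ℕ) (p : unitInterval) (t : ℝ) :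
    ∫ k, Complex.exp (t * (k : ℝ) * Complex.I) ∂(binomial N p) =
      (1 + p * (Complex.exp (t * Complex.I) - 1)) ^ N := by
  rw [integral_binomial,
    show 1 + (p : ℂ) * (Complex.exp (t * Complex.I) - 1) =
      p * Complex.exp (t * Complex.I) + (1 - p) by ring, add_pow,
    show Finset.range (N + 1) = Finset.Iic N by ext; simp]
  refine Finset.sum_congr rfl fun k _ => ?_
  rw [mul_pow, ← Complex.exp_nat_mul, Complex.real_smul]
  push_cast
  rw [show (t : ℂ) * k * Complex.I = k * (t * Complex.I) by ring]
  ring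

theorem tendsto_inv_sqrt_nhdsNE_zero :
    Tendsto (fun N : ℕ => (√N)⁻¹) atTop (𝓝[≠] (0 : ℝ)) := by
  refine tendsto_nhdsWithin_iff.2 ⟨?_, ?_⟩
  · exact tendsto_inv_atTop_zero.comp
      (Real.tendsto_sqrt_atTop.comp tendsto_natCast_atTop_atTop)
  · filter_upwards [eventually_gt_atTop 0] with N hN
    have : 0 < √(N : ℝ) := Real.sqrt_pos.2 (by exact_mod_cast hN)
    simpa using this.ne'

theorem tendsto_sqrt_mul_exp_sub_one (t : ℝ) :
    Tendsto (fun N : ℕ => (√N : ℂ) * (Complex.exp ((t / √N : ℝ) * Complex.I) - 1)) atTop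
      (𝓝 (t * Complex.I)) := by
  have hd : HasDerivAt (fun s : ℝ => Complex.exp (s * (t * Complex.I))) (t * Complex.I) 0 := by
    have h := ((hasDerivAt_id (0 : ℝ)).ofReal_comp.mul_const (t * Complex.I)).cexp
    simpa using h
  refine (hd.tendsto_slope.comp tendsto_inv_sqrt_nhdsNE_zero).congr fun N => ?_
  simp only [Function.comp_apply, slope_def_module, sub_zero, inv_inv, Complex.real_smul,
    Complex.ofReal_zero, zero_mul, Complex.exp_zero]
  congr 3
  push_cast
  ring

/-- Central limit theorem for the difference of two independent binomial variables with a common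
number of trials whose success probabilities differ by a term of order `1 / √N`. -/
theorem tendsto_binomial_prod_real_le {p : unitInterval} {r : ℕ → unitInterval} {c : ℝ}
    {v : NNReal} (hv : (v : ℝ) = 2 * (p * (1 - p))) (hv0 : v ≠ 0)
    (hr : Tendsto (fun N : ℕ => √N * ((r N : ℝ) - p)) atTop (𝓝 c)) :
    Tendsto (fun N : ℕ => ((binomial N p).prod (binomial N (r N))).real {z | z.1 ≤ z.2}) atTop
      (𝓝 ((gaussianReal c v).real (Set.Ici 0))) := by
  let D (N : ℕ) (z : ℕ × ℕ) : ℝ := (√N)⁻¹ * ((z.2 : ℝ) - z.1)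
  have hD (N : ℕ) : Measurable (D N) := .of_discrete
  let ν (N : ℕ) : ProbabilityMeasure ℝ :=
    ⟨((binomial N p).prod (binomial N (r N))).map (D N),
      Measure.isProbabilityMeasure_map (hD N).aemeasurable⟩
  have hchar (N : ℕ) (t : ℝ) : charFun (ν N : Measure ℝ) t =
      ((1 + p * (Complex.exp ((-t / √N : ℝ) * Complex.I) - 1)) *
        (1 + r N * (Complex.exp ((t / √N : ℝ) * Complex.I) - 1))) ^ N := by
    rw [charFun_apply_real, ProbabilityMeasure.coe_mk,
      integral_map (hD N).aemeasurable (by fun_prop), mul_pow, ← integral_exp_mul_I_binomial,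
      ← integral_exp_mul_I_binomial, ← integral_prod_mul]
    congr 1 with z
    rw [← Complex.exp_add]
    congr 1
    simp only [D]
    push_cast
    ring
  have hsqrt : Tendsto (fun N : ℕ => (√N)⁻¹) atTop (𝓝 (0 : ℝ)) :=
    tendsto_nhds_of_tendsto_nhdsWithin tendsto_inv_sqrt_nhdsNE_zero
  have hr0 : Tendsto (fun N : ℕ => (r N : ℝ)) atTop (𝓝 p) := by
    have h := (hsqrt.mul hr).add_const (p : ℝ)
    rw [zero_mul, zero_add] at h
    refine h.congr' ?_
    filter_upwards [eventually_gt_atTop 0] with N hN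
    have : 0 < √(N : ℝ) := Real.sqrt_pos.2 (by exact_mod_cast hN)
    field_simp
    ring
  have hlim : Tendsto ν atTop (𝓝 ⟨gaussianReal c v, inferInstance⟩) := by
    refine ProbabilityMeasure.tendsto_iff_tendsto_charFun.2 fun t => ?_
    simp only [hchar, ProbabilityMeasure.coe_mk, charFun_gaussianReal]
    have key : Tendsto (fun N : ℕ => (N : ℂ) *
        ((1 + p * (Complex.exp ((-t / √N : ℝ) * Complex.I) - 1)) *
          (1 + r N * (Complex.exp ((t / √N : ℝ) * Complex.I) - 1)) - 1)) atTop
        (𝓝 (t * c * Complex.I - v * t ^ 2 / 2)) := by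
      have hu := tendsto_sqrt_mul_exp_sub_one t
      have hw := tendsto_sqrt_mul_exp_sub_one (-t)
      have hrC : Tendsto (fun N : ℕ => (√N : ℂ) * ((r N : ℂ) - p)) atTop (𝓝 c) := by
        simpa only [Function.comp_def, Complex.ofReal_mul, Complex.ofReal_sub] using
          (Complex.continuous_ofReal.tendsto c).comp hr
      have hr0C : Tendsto (fun N : ℕ => (r N : ℂ)) atTop (𝓝 p) :=
        (Complex.continuous_ofReal.tendsto (p : ℝ)).comp hr0
      have h := (hrC.mul hu).sub
        (((hr0C.const_sub 1).const_mul (p : ℂ)).mul (hu.mul hw))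
      have hval : (c : ℂ) * (t * Complex.I) -
          p * (1 - p) * (t * Complex.I * ((-t : ℝ) * Complex.I)) =
            t * c * Complex.I - v * t ^ 2 / 2 := by
        have hvC : (v : ℂ) = 2 * (p * (1 - p)) := by exact_mod_cast congrArg Complex.ofReal hv
        rw [hvC]
        push_cast
        linear_combination (p : ℂ) * (1 - p) * t ^ 2 * Complex.I_sq
      rw [hval] at h
      refine h.congr fun N => ?_
      have hinv : Complex.exp ((t / √N : ℝ) * Complex.I) *
          Complex.exp ((-t / √N : ℝ) * Complex.I) = 1 := by
        rw [← Complex.exp_add]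
        simp [neg_div]
      have hN : (√N : ℂ) * √N = N := by
        rw [← Complex.ofReal_mul, Real.mul_self_sqrt (Nat.cast_nonneg N)]; simp
      generalize Complex.exp ((t / √N : ℝ) * Complex.I) = a at hinv ⊢
      generalize Complex.exp ((-t / √N : ℝ) * Complex.I) = b at hinv ⊢
      rw [← hN]
      linear_combination (-(√N : ℂ) ^ 2 * p) * hinv
    simpa using Complex.tendsto_one_add_pow_exp_of_tendsto key
  have hnull : (gaussianReal c v) (frontier (Set.Ici (0 : ℝ))) = 0 := by
    have := nullSingletonClass_gaussianReal (μ := c) hv0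
    rw [frontier_Ici]
    exact measure_singleton _
  have hport := ProbabilityMeasure.tendsto_measure_of_null_frontier_of_tendsto' hlim hnull
  refine ((ENNReal.tendsto_toReal (measure_ne_top (gaussianReal c v) _)).comp hport).congr' ?_
  filter_upwards [eventually_gt_atTop 0] with N hN
  have hpos : 0 < √(N : ℝ) := Real.sqrt_pos.2 (by exact_mod_cast hN)
  simp only [Function.comp_apply, ν, ProbabilityMeasure.coe_mk]
  rw [Measure.map_apply (hD N) measurableSet_Ici, measureReal_def]
  congr 2 with z
  simp [D, hpos]

theorem gaussianReal_real_Ici_zero_eq_real_Iic {v w : NNReal} {a x : ℝ} (ha : 0 < a)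
    (hvw : (v : ℝ) = a ^ 2 * w) :
    (gaussianReal (a * x) v).real (Set.Ici 0) = (gaussianReal 0 w).real (Set.Iic x) := by
  have h : gaussianReal (a * x) v =
      ((gaussianReal 0 w).map (-a * ·)).map (· + a * x) := by
    rw [gaussianReal_map_const_mul, gaussianReal_map_add_const]
    congr 1
    · ring
    · ext; simp [hvw]
  rw [h, Measure.map_map (by fun_prop) (by fun_prop),
    map_measureReal_apply (by fun_prop) measurableSet_Ici]
  congr 1 with u
  simp only [Set.mem_preimage, Function.comp_apply, Set.mem_Ici, Set.mem_Iic]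
  rw [show -a * u + a * x = a * (x - u) by ring, mul_nonneg_iff_of_pos_left ha, sub_nonneg]

theorem binomial_prod_real_le (N : ℕ) (p r : unitInterval) :
    ((binomial N p).prod (binomial N r)).real {z | z.1 ≤ z.2} =
      ∑ k ∈ Finset.Iic N, (N.choose k * (p : ℝ) ^ k * (1 - p) ^ (N - k)) *
        (binomial N r).real (Set.Ici k) := by
  have hs : MeasurableSet {z : ℕ × ℕ | z.1 ≤ z.2} := .of_discrete
  refine Eq.trans ?_ (integral_binomial fun k => (binomial N r).real (Set.Ici k))
  rw [← integral_indicator_one hs,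
    integral_prod _ (Integrable.indicator (f := (1 : ℕ × ℕ → ℝ)) (integrable_const 1) hs)]
  congr 1 with k
  rw [← integral_indicator_one (measurableSet_Ici (a := k))]
  rfl

/-- A real random variable which, given a binomial index, is distributed as the order statistic
of that index: its distribution function compares two independent binomial variables, up to the
probability that the index vanishes. -/
theorem abs_measureReal_sub_binomial_prod_real_le {Ω : Type*} [MeasurableSpace Ω] {μ : Measure Ω}
    [IsProbabilityMeasure μ] {f F : ℝ → ℝ} (hf : Integrable f)
    (hF : ∀ x, F x = ∫ u in Set.Iic x, f u) {N : ℕ} {p : unitInterval} {X : Ω → ℕ} {Y : Ω → ℝ}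
    (hX : ∀ j, μ {ω | X ω = j} = binomial N p {j})
    (hY : ∀ n : ℕ, 1 ≤ n → n ≤ N → ∀ x : ℝ,
      μ {ω | Y ω ≤ x ∧ X ω = n} = μ {ω | X ω = n} *
        ENNReal.ofReal (∫ u in Set.Iic x,
          ((N.factorial : ℝ) / (((n - 1).factorial : ℝ) * ((N - n).factorial : ℝ))) *
            F u ^ (n - 1) * (1 - F u) ^ (N - n) * f u))
    {y : ℝ} {r : unitInterval} (hr : (r : ℝ) = F y) :
    |μ.real {ω | Y ω ≤ y} - ((binomial N p).prod (binomial N r)).real {z | z.1 ≤ z.2}| ≤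
      (1 - p : ℝ) ^ N := by
  have htsum : ∑' j, μ {ω | X ω = j} ≤ μ Set.univ := by
    simp only [hX]
    rw [measure_univ, ← measure_univ (μ := binomial N p), ← Set.iUnion_of_singleton,
      measure_iUnion (fun i j hij => by simpa using hij) (fun _ => measurableSet_singleton _)]
  have hzero {j : ℕ} (hj : N < j) : μ {ω | X ω = j} = 0 := by
    simp [hX, binomial_singleton, Nat.choose_eq_zero_of_lt hj]
  have hsum : μ.real {ω | Y ω ≤ y} = ∑ n ∈ Finset.Iic N, μ.real {ω | Y ω ≤ y ∧ X ω = n} := by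
    rw [measureReal_def, measure_eq_tsum_inter_fiber_s11 htsum,
      tsum_eq_sum (s := Finset.Iic N), ENNReal.toReal_sum fun _ _ => measure_ne_top _ _]
    · rfl
    · intro j hj
      exact measure_mono_null (fun ω hω => hω.2) (hzero (by simpa using hj))
  have hterm {n : ℕ} (hn : 1 ≤ n) (hnN : n ≤ N) : μ.real {ω | Y ω ≤ y ∧ X ω = n} =
      (N.choose n * (p : ℝ) ^ n * (1 - p) ^ (N - n)) * (binomial N r).real (Set.Ici n) := by
    rw [measureReal_def, hY n hn hnN, integral_orderStatistic_density hf hF hn hnN y r hr, hX,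
      ENNReal.toReal_mul, ENNReal.toReal_ofReal measureReal_nonneg, ← measureReal_def,
      binomial_real_singleton]
  rw [hsum, binomial_prod_real_le, ← Finset.sum_sub_distrib,
    Finset.sum_eq_single_of_mem 0 (by simp)]
  · have h0 : μ.real {ω | Y ω ≤ y ∧ X ω = 0} ≤ (1 - p : ℝ) ^ N := by
      refine (measureReal_mono (s₂ := {ω | X ω = 0}) fun ω hω => hω.2).trans (le_of_eq ?_)
      rw [measureReal_def, hX, ← measureReal_def, binomial_real_zero]
    have hIci : Set.Ici (0 : ℕ) = Set.univ := by ext; simp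
    have hnonneg : (0 : ℝ) ≤ μ.real {ω | Y ω ≤ y ∧ X ω = 0} := measureReal_nonneg
    rw [hIci, probReal_univ, abs_le]
    simp only [Nat.choose_zero_right, Nat.cast_one, pow_zero, mul_one, one_mul, Nat.sub_zero]
    constructor <;> linarith
  · intro n hn hn0
    rw [hterm (Nat.one_le_iff_ne_zero.2 hn0) (by simpa using hn), sub_self]

theorem HasDerivAt.tendsto_sqrt_mul_sub {F : ℝ → ℝ} {a q : ℝ} (h : HasDerivAt F a q) (x : ℝ) :
    Tendsto (fun N : ℕ => √N * (F (q + x / √N) - F q)) atTop (𝓝 (a * x)) := by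
  have hg : HasDerivAt (fun s : ℝ => F (q + s * x)) (a * x) 0 := by
    have hinner : HasDerivAt (fun s : ℝ => q + s * x) x 0 := by
      simpa using ((hasDerivAt_id (0 : ℝ)).mul_const x).const_add q
    exact HasDerivAt.comp (0 : ℝ) (by simpa using h) hinner
  refine (hg.tendsto_slope.comp tendsto_inv_sqrt_nhdsNE_zero).congr fun N => ?_
  simp [slope_def_module, div_eq_inv_mul]

theorem hasDerivAt_integral_Iic {f : ℝ → ℝ} (hf : Integrable f) {q : ℝ} (hq : ContinuousAt f q) :
    HasDerivAt (fun x => ∫ u in Set.Iic x, f u) (f q) q := by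
  have h := (intervalIntegral.integral_hasDerivAt_right (hf.intervalIntegrable (a := 0) (b := q))
    (hf.aestronglyMeasurable.stronglyMeasurableAtFilter) hq).const_add (∫ u in Set.Iic 0, f u)
  refine h.congr_of_eventuallyEq (Eventually.of_forall fun x => ?_)
  simp only
  rw [← intervalIntegral.integral_Iic_sub_Iic hf.integrableOn hf.integrableOn]
  ring

/-- Fix `α ∈ (0,1)` and an absolutely continuous distribution `F` with
density `f`, `f` continuous and strictly positive at `q = F⁻¹(1−α)`.  For each `N ≥ 1`, let
`n_N` be binomial with parameters `N` and `1−α`, and conditionally on `n_N = n` with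
`1 ≤ n ≤ N`, let `L_N` be distributed as the `n`-th order statistic of an i.i.d. `N`-sample
from `F` (density `x ↦ N!/((n−1)!(N−n)!) F(x)^{n−1}(1−F(x))^{N−n} f(x)`).  Then
`√N (L_N − q)` converges in distribution to the centered normal law with standard deviation
`√2 √(α(1−α))/f(q)` (expressed via pointwise convergence of distribution functions). -/
theorem stmt_11 {Ω : Type*} [MeasurableSpace Ω] (μ : Measure Ω) [IsProbabilityMeasure μ]
    (α : ℝ) (hα : α ∈ Set.Ioo (0 : ℝ) 1)
    (f : ℝ → ℝ) (hf0 : ∀ x, 0 ≤ f x) (hf1 : ∫ x, f x = 1)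
    (F : ℝ → ℝ) (hF : ∀ x, F x = ∫ u in Set.Iic x, f u)
    (q : ℝ) (hq : F q = 1 - α) (hfq : 0 < f q) (hfcont : ContinuousAt f q)
    (nn : ℕ → Ω → ℕ) (L : ℕ → Ω → ℝ)
    (hnn : ∀ N : ℕ, 1 ≤ N → ∀ j : ℕ,
      μ {ω | nn N ω = j}
        = ENNReal.ofReal ((N.choose j : ℝ) * (1 - α) ^ j * α ^ (N - j)))
    (hL : ∀ N n : ℕ, 1 ≤ n → n ≤ N → ∀ x : ℝ,
      μ {ω | L N ω ≤ x ∧ nn N ω = n}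
        = μ {ω | nn N ω = n} *
            ENNReal.ofReal (∫ u in Set.Iic x,
              ((N.factorial : ℝ) / (((n - 1).factorial : ℝ) * ((N - n).factorial : ℝ))) *
                F u ^ (n - 1) * (1 - F u) ^ (N - n) * f u)) :
    ∀ x : ℝ,
      Tendsto (fun N : ℕ => (μ {ω | Real.sqrt (N : ℝ) * (L N ω - q) ≤ x}).toReal)
        atTop
        (𝓝 ((gaussianReal 0
              (Real.toNNReal ((Real.sqrt 2 * Real.sqrt (α * (1 - α)) / f q) ^ 2))
              (Set.Iic x)).toReal)) := by
  intro x
  have hf : Integrable f := by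
    by_contra h
    simp [integral_undef h] at hf1
  have hFmem (y : ℝ) : F y ∈ unitInterval := by
    rw [hF]
    exact ⟨setIntegral_nonneg measurableSet_Iic fun u _ => hf0 u,
      hf1 ▸ setIntegral_le_integral hf (ae_of_all _ hf0)⟩
  let p : unitInterval := ⟨F q, hFmem q⟩
  let r (N : ℕ) : unitInterval := ⟨F (q + x / √N), hFmem _⟩
  have hp : (p : ℝ) = 1 - α := hq
  have hαα : 0 < α * (1 - α) := mul_pos hα.1 (sub_pos.2 hα.2)
  have hr : Tendsto (fun N : ℕ => √N * ((r N : ℝ) - p)) atTop (𝓝 (f q * x)) := by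
    refine HasDerivAt.tendsto_sqrt_mul_sub ?_ x
    rw [show F = fun x => ∫ u in Set.Iic x, f u from funext hF]
    exact hasDerivAt_integral_Iic hf hfcont
  have hv : ((2 * (α * (1 - α))).toNNReal : ℝ) = 2 * (p * (1 - p)) := by
    rw [Real.coe_toNNReal _ (by positivity), hp]; ring
  have hlim := tendsto_binomial_prod_real_le hv (by simpa using hαα) hr
  have hvw : ((2 * (α * (1 - α))).toNNReal : ℝ) =
      f q ^ 2 * ((√2 * √(α * (1 - α)) / f q) ^ 2).toNNReal := by
    rw [Real.coe_toNNReal _ (by positivity), Real.coe_toNNReal _ (by positivity), div_pow,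
      mul_pow, Real.sq_sqrt zero_le_two, Real.sq_sqrt hαα.le]
    field_simp
  rw [gaussianReal_real_Ici_zero_eq_real_Iic hfq hvw] at hlim
  refine (tendsto_iff_of_dist ?_).1 hlim
  refine squeeze_zero' (Eventually.of_forall fun _ => dist_nonneg) ?_
    (tendsto_pow_atTop_nhds_zero_of_lt_one hα.1.le hα.2)
  filter_upwards [eventually_ge_atTop 1] with N hN
  have hpos : 0 < √(N : ℝ) := Real.sqrt_pos.2 (by exact_mod_cast hN)
  have hset : {ω | √N * (L N ω - q) ≤ x} = {ω | L N ω ≤ q + x / √N} := by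
    ext ω
    rw [Set.mem_ofPred_eq, Set.mem_ofPred_eq, ← le_div_iff₀' hpos, sub_le_iff_le_add']
  have hbound := abs_measureReal_sub_binomial_prod_real_le hf hF (p := p) (r := r N)
    (fun j => by rw [hnn N hN j, binomial_singleton, hp, sub_sub_cancel]) (hL N) rfl
  rw [dist_comm, Real.dist_eq, hset, ← measureReal_def]
  simpa only [hp, sub_sub_cancel] using hbound
end
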